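/- arXiv:2506.10681 — 2 statements merged into one kernel-verified Lean document; each statement's English description precedes it below -/
import Mathlib

section
/- Let s > -1, r, t > 0 with r + t - s > 2 and t > s + 2 > r. Then there exists a constant C > 0 such that for all b, z in the open unit disk, ∫_{𝔻} (1-|w|²)^s / (|1 - conj(b)·w|^r · |1 - conj(z)·w|^t) dA(w) ≤ C / (|1 - conj(b)·z|^r · (1-|z|²)^{t-s-2}). -/
open Complex MeasureTheory Real Set Metric ComplexConjugate

lemma lint_Ioc (p c : ℝ) (hp : 0 < p) (hc : 0 < c) :
    ∫⁻ x in Ioc 0 c, ENNReal.ofReal (x ^ (p - 1)) = ENNReal.ofReal (c ^ p / p) := by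
  have hi : IntervalIntegrable (fun x : ℝ => x ^ (p - 1)) volume 0 c :=
    intervalIntegral.intervalIntegrable_rpow' (by linarith)
  rw [← ofReal_integral_eq_lintegral_ofReal, ← intervalIntegral.integral_of_le hc.le,
    integral_rpow (Or.inl (by linarith))]
  · simp [Real.zero_rpow hp.ne']
  · exact (intervalIntegrable_iff_integrableOn_Ioc_of_le hc.le).1 hi
  · filter_upwards [ae_restrict_mem measurableSet_Ioc] with x hx
    exact Real.rpow_nonneg hx.1.le _

lemma lint_Ioi (p c : ℝ) (hp : 0 < p) (hc : 0 < c) :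
    ∫⁻ x in Ioi c, ENNReal.ofReal (x ^ (-p - 1)) = ENNReal.ofReal (c ^ (-p) / p) := by
  rw [← ofReal_integral_eq_lintegral_ofReal, integral_Ioi_rpow_of_lt (by linarith) hc]
  · congr 1; simp [neg_div_neg_eq]
  · exact integrableOn_Ioi_rpow_of_lt (by linarith) hc
  · filter_upwards [ae_restrict_mem measurableSet_Ioi] with x hx
    exact Real.rpow_nonneg (hc.le.trans (le_of_lt hx)) _

lemma L1 {α : Type*} [MeasurableSpace α] (ν : Measure α) (g : α → ℝ) (hg : Measurable g)
    (hg0 : ∀ x, 0 ≤ g x) (K a t h : ℝ) (hK : 0 < K) (ht0 : 0 < t) (ht : a < t) (hh : 0 < h)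
    (hν : ∀ δ > 0, ν {x | g x < δ} ≤ ENNReal.ofReal (K * δ ^ a))
    (hgh : ∀ᵐ x ∂ν, h ≤ g x) :
    ∫⁻ x, ENNReal.ofReal ((g x)⁻¹ ^ t) ∂ν ≤ ENNReal.ofReal (t * K / (t - a) * h ^ (a - t)) := by
  rw [lintegral_rpow_eq_lintegral_meas_lt_mul ν (f := fun x => (g x)⁻¹)
    (Filter.Eventually.of_forall fun x => inv_nonneg.2 (hg0 x)) hg.inv.aemeasurable ht0]
  have key : ∫⁻ x in Ioi (0:ℝ), ν {y | x < (g y)⁻¹} * ENNReal.ofReal (x ^ (t - 1)) ≤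
      ∫⁻ x in Ioc 0 h⁻¹, ENNReal.ofReal K * ENNReal.ofReal (x ^ (t - a - 1)) := by
    rw [← Ioc_union_Ioi_eq_Ioi (inv_pos.2 hh).le,
      lintegral_union measurableSet_Ioi (by
        rw [Set.disjoint_left]; intro x hx hx'; exact absurd hx.2 (not_le.2 hx'))]
    have h0 : ∫⁻ x in Ioi h⁻¹, ν {y | x < (g y)⁻¹} * ENNReal.ofReal (x ^ (t - 1)) = 0 := by
      rw [setLIntegral_congr_fun (g := fun _ => 0) measurableSet_Ioi]
      · simp
      · intro x hx
        have : ν {y | x < (g y)⁻¹} = 0 := by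
          refine measure_mono_null ?_ (ae_iff.1 hgh)
          intro y hy
          simp only [mem_ofPred_eq, mem_Ioi] at hy hx ⊢
          intro h'
          have := inv_anti₀ hh h'
          linarith
        simp [this]
    rw [h0, add_zero]
    refine setLIntegral_mono (by fun_prop) ?_
    intro x hx
    have hx0 := hx.1
    have : ν {y | x < (g y)⁻¹} ≤ ENNReal.ofReal (K * x⁻¹ ^ a) := by
      refine (measure_mono ?_).trans (hν x⁻¹ (inv_pos.2 hx0))
      intro y hy
      simp only [mem_ofPred_eq] at hy ⊢
      have := inv_strictAnti₀ hx0 hy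
      simpa using this
    refine (mul_le_mul_left this _).trans ?_
    rw [← ENNReal.ofReal_mul (by positivity), ← ENNReal.ofReal_mul hK.le]
    apply le_of_eq
    congr 1
    rw [Real.inv_rpow hx0.le, ← Real.rpow_neg hx0.le, mul_assoc, ← Real.rpow_add hx0]
    congr 2; ring
  refine (mul_le_mul_right key _).trans ?_
  rw [lintegral_const_mul _ (by fun_prop), lint_Ioc (t - a) h⁻¹ (by linarith) (inv_pos.2 hh),
    ← ENNReal.ofReal_mul hK.le, ← ENNReal.ofReal_mul ht0.le]
  apply le_of_eq
  congr 1
  rw [Real.inv_rpow hh.le, ← Real.rpow_neg hh.le, neg_sub]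
  ring

lemma L2 {α : Type*} [MeasurableSpace α] (ν : Measure α) (g : α → ℝ) (hg : Measurable g)
    (hg0 : ∀ x, 0 ≤ g x) (K a r δ : ℝ) (hK : 0 < K) (hr0 : 0 < r) (hr : r < a) (hδ : 0 < δ)
    (hν : ∀ δ > 0, ν {x | g x < δ} ≤ ENNReal.ofReal (K * δ ^ a)) :
    ∫⁻ x in {x | g x < δ}, ENNReal.ofReal ((g x)⁻¹ ^ r) ∂ν ≤
      ENNReal.ofReal ((K + r * K / (a - r)) * δ ^ (a - r)) := by
  rw [lintegral_rpow_eq_lintegral_meas_lt_mul _ (f := fun x => (g x)⁻¹)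
    (Filter.Eventually.of_forall fun x => inv_nonneg.2 (hg0 x)) hg.inv.aemeasurable hr0]
  have hS : MeasurableSet {x | g x < δ} := measurableSet_lt hg measurable_const
  have hb1 : ∀ x : ℝ, (ν.restrict {x | g x < δ}) {y | x < (g y)⁻¹} ≤
      ENNReal.ofReal (K * δ ^ a) := fun x =>
    (measure_mono (subset_univ _)).trans (by simpa using hν δ hδ)
  have hb2 : ∀ x : ℝ, 0 < x → (ν.restrict {x | g x < δ}) {y | x < (g y)⁻¹} ≤
      ENNReal.ofReal (K * x⁻¹ ^ a) := by
    intro x hx0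
    refine (Measure.restrict_apply_le _ _).trans
      ((measure_mono ?_).trans (hν x⁻¹ (inv_pos.2 hx0)))
    intro y hy
    simp only [mem_ofPred_eq] at hy ⊢
    have := inv_strictAnti₀ hx0 hy
    simpa using this
  have key : ∫⁻ x in Ioi (0:ℝ), (ν.restrict {x | g x < δ}) {y | x < (g y)⁻¹}
        * ENNReal.ofReal (x ^ (r - 1)) ≤
      (∫⁻ x in Ioc 0 δ⁻¹, ENNReal.ofReal (K * δ ^ a) * ENNReal.ofReal (x ^ (r - 1))) +
      ∫⁻ x in Ioi δ⁻¹, ENNReal.ofReal K * ENNReal.ofReal (x ^ (-(a - r) - 1)) := by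
    rw [← Ioc_union_Ioi_eq_Ioi (inv_pos.2 hδ).le,
      lintegral_union measurableSet_Ioi (by
        rw [Set.disjoint_left]; intro x hx hx'; exact absurd hx.2 (not_le.2 hx'))]
    gcongr ?_ + ?_
    · refine setLIntegral_mono (by fun_prop) ?_
      intro x hx
      exact mul_le_mul_left (hb1 x) _
    · refine setLIntegral_mono (by fun_prop) ?_
      intro x hx
      have hx0 : 0 < x := (inv_pos.2 hδ).trans hx
      refine (mul_le_mul_left (hb2 x hx0) _).trans ?_
      rw [← ENNReal.ofReal_mul (by positivity), ← ENNReal.ofReal_mul hK.le]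
      apply le_of_eq
      congr 1
      rw [Real.inv_rpow hx0.le, ← Real.rpow_neg hx0.le, mul_assoc, ← Real.rpow_add hx0]
      congr 2; ring
  refine (mul_le_mul_right key _).trans ?_
  have har : 0 < a - r := by linarith
  rw [lintegral_const_mul _ (by fun_prop), lintegral_const_mul _ (by fun_prop),
    lint_Ioc r δ⁻¹ hr0 (inv_pos.2 hδ), lint_Ioi (a - r) δ⁻¹ har (inv_pos.2 hδ),
    ← ENNReal.ofReal_mul hK.le, ← ENNReal.ofReal_mul (by positivity),
    ← ENNReal.ofReal_add (by positivity) (by positivity), ← ENNReal.ofReal_mul hr0.le]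
  apply le_of_eq
  congr 1
  rw [Real.inv_rpow hδ.le, ← Real.rpow_neg hδ.le, Real.inv_rpow hδ.le, ← Real.rpow_neg hδ.le,
    neg_neg, sub_eq_add_neg a r, Real.rpow_add hδ]
  have : a + -r ≠ 0 := by linarith
  field_simp

lemma ang (c θ : ℝ) (hc : 0 ≤ c) (hθ : |θ| ≤ π) :
    |θ| ≤ π * ‖(1:ℂ) - c * (Real.cos θ + Real.sin θ * I)‖ := by
  have h := Real.cos_le_one_sub_mul_cos_sq hθ
  have hn : ‖(1:ℂ) - c * (Real.cos θ + Real.sin θ * I)‖ ^ 2 = (1 - c)^2 + 2 * c * (1 - Real.cos θ) := by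
    have e : (1:ℂ) - c * (Real.cos θ + Real.sin θ * I) =
      ((1 - c * Real.cos θ : ℝ) : ℂ) + ((-(c * Real.sin θ) : ℝ) : ℂ) * I := by push_cast; ring
    rw [e, Complex.sq_norm, Complex.normSq_add_mul_I]
    nlinarith [Real.sin_sq_add_cos_sq θ]
  apply abs_le_of_sq_le_sq' _ (by positivity) |>.2
  rw [mul_pow, hn, sq_abs]
  have hp := Real.pi_pos
  have h2 : θ ^ 2 ≤ π ^ 2 := sq_le_sq' (by linarith [abs_le.1 hθ]) (abs_le.1 hθ).2
  have h3 : 2 * θ^2 ≤ π ^ 2 * (1 - Real.cos θ) := by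
    have : 2 / π ^ 2 * θ ^ 2 ≤ 1 - Real.cos θ := by linarith
    calc 2 * θ ^ 2 = π ^ 2 * (2 / π ^ 2 * θ ^ 2) := by field_simp
      _ ≤ _ := by gcongr
  nlinarith [mul_le_mul_of_nonneg_left h3 hc, mul_le_mul_of_nonneg_left h2 (sq_nonneg (1 - c)), mul_nonneg (sq_nonneg θ) hc, mul_nonneg (sq_nonneg θ) (sq_nonneg c)]

lemma tri (b z w : ℂ) (hb : ‖b‖ < 1) (hz : ‖z‖ < 1) (hw : ‖w‖ < 1) :
    ‖1 - conj b * z‖ ≤ ‖1 - conj b * w‖ + ‖1 - conj z * w‖ := by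
  have h1 : ‖w - z‖ ≤ ‖1 - conj z * w‖ := by
    apply abs_le_of_sq_le_sq' _ (by positivity) |>.2
    have e : ‖1 - conj z * w‖ ^ 2 = ‖w - z‖ ^ 2 + (1 - ‖z‖ ^ 2) * (1 - ‖w‖ ^ 2) := by
      simp only [Complex.sq_norm, Complex.normSq_apply]
      simp
      ring
    rw [e]
    have : ‖z‖ ^ 2 ≤ 1 := pow_le_one₀ (norm_nonneg _) hz.le
    have : ‖w‖ ^ 2 ≤ 1 := pow_le_one₀ (norm_nonneg _) hw.le
    nlinarith
  calc ‖1 - conj b * z‖ = ‖(1 - conj b * w) + conj b * (w - z)‖ := by congr 1; ring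
    _ ≤ ‖1 - conj b * w‖ + ‖conj b * (w - z)‖ := norm_add_le _ _
    _ ≤ _ := by
      gcongr
      rw [norm_mul, RCLike.norm_conj]
      nlinarith [norm_nonneg (w - z)]

lemma low (b w : ℂ) (hb : ‖b‖ < 1) : 1 - ‖w‖ ≤ ‖1 - conj b * w‖ := by
  have := norm_sub_norm_le (1:ℂ) (conj b * w)
  rw [norm_mul, RCLike.norm_conj, norm_one] at this
  nlinarith [norm_nonneg w]

lemma mS (a : ℂ) (δ : ℝ) : MeasurableSet {w : ℂ | ‖w‖ < 1 ∧ ‖1 - a * w‖ < δ} :=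
  (measurableSet_lt (f := fun w : ℂ => ‖w‖) (g := fun _ => 1) (by fun_prop) (by fun_prop)).inter
    (measurableSet_lt (f := fun w : ℂ => ‖1 - a * w‖) (g := fun _ => δ) (by fun_prop) (by fun_prop))

lemma K0 (s c δ : ℝ) (hs : -1 < s) (hc : 0 ≤ c) (hc1 : c < 1) (hδ : 0 < δ) :
    ∫⁻ w in {w : ℂ | ‖w‖ < 1 ∧ ‖1 - c * w‖ < δ}, ENNReal.ofReal ((1 - ‖w‖ ^ 2) ^ s) ≤
      ENNReal.ofReal (2 ^ |s| * (2 * π / (s + 1)) * δ ^ (s + 2)) := by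
  have hS : MeasurableSet {w : ℂ | ‖w‖ < 1 ∧ ‖1 - c * w‖ < δ} := mS c δ
  rw [← lintegral_indicator hS, ← Complex.lintegral_comp_polarCoord_symm]
  set F0 : ℝ → ENNReal := (Ioc 0 δ).indicator
    (fun y => ENNReal.ofReal (2 ^ |s|) * ENNReal.ofReal (y ^ (s + 1 - 1))) with hF0
  set G : ℝ → ENNReal := (Ioo (-(π * δ)) (π * δ)).indicator (fun _ => 1) with hG
  have hF0m : Measurable F0 := Measurable.indicator (by fun_prop) measurableSet_Ioc
  have hGm : Measurable G := Measurable.indicator (by fun_prop) measurableSet_Ioo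
  have step : ∫⁻ p in polarCoord.target, ENNReal.ofReal p.1 •
      ({w : ℂ | ‖w‖ < 1 ∧ ‖1 - c * w‖ < δ}.indicator
        (fun w => ENNReal.ofReal ((1 - ‖w‖ ^ 2) ^ s))) (Complex.polarCoord.symm p) ≤
      ∫⁻ p : ℝ × ℝ, F0 (1 - p.1) * G p.2 := by
    refine (setLIntegral_mono (g := fun p : ℝ × ℝ => F0 (1 - p.1) * G p.2) (by fun_prop) ?_).trans
      (setLIntegral_le_lintegral _ _)
    rintro ⟨ρ, θ⟩ hp
    rw [polarCoord_target] at hp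
    obtain ⟨hρ, hθ⟩ := hp
    simp only [mem_Ioi, mem_Ioo] at hρ hθ
    set w := Complex.polarCoord.symm (ρ, θ) with hw
    have hwn : ‖w‖ = ρ := by
      rw [hw, Complex.norm_polarCoord_symm]; exact abs_of_pos hρ
    by_cases hm : w ∈ {w : ℂ | ‖w‖ < 1 ∧ ‖1 - c * w‖ < δ}
    · rw [indicator_of_mem hm]
      obtain ⟨h1, h2⟩ := hm
      rw [hwn] at h1
      have hρ1 : 1 - ρ < δ := by
        have := norm_sub_norm_le (1:ℂ) (c * w)
        rw [norm_mul, hwn, norm_one, Complex.norm_real, Real.norm_of_nonneg hc] at this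
        nlinarith
      have hθ1 : |θ| < π * δ := by
        have := ang (c * ρ) θ (by positivity) (abs_le.2 ⟨hθ.1.le, hθ.2.le⟩)
        refine this.trans_lt ?_
        have e : (1:ℂ) - ((c * ρ : ℝ) : ℂ) * (Real.cos θ + Real.sin θ * I) = 1 - c * w := by
          rw [hw, Complex.polarCoord_symm_apply]; push_cast; ring
        rw [e]
        exact mul_lt_mul_of_pos_left h2 Real.pi_pos
      simp only
      rw [hF0, hG, indicator_of_mem (show 1 - ρ ∈ Ioc 0 δ from ⟨by linarith, hρ1.le⟩),
        indicator_of_mem (show θ ∈ Ioo (-(π * δ)) (π * δ) from abs_lt.1 hθ1), mul_one, smul_eq_mul,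
        hwn, ← ENNReal.ofReal_mul hρ.le, ← ENNReal.ofReal_mul (by positivity)]
      apply ENNReal.ofReal_le_ofReal
      rw [add_sub_cancel_right, show 1 - ρ ^ 2 = (1 + ρ) * (1 - ρ) by ring,
        Real.mul_rpow (by linarith) (by linarith), ← mul_assoc]
      have hq : (0:ℝ) ≤ (1 - ρ) ^ s := Real.rpow_nonneg (by linarith) _
      apply mul_le_mul_of_nonneg_right _ hq
      calc ρ * (1 + ρ) ^ s ≤ 1 * (1 + ρ) ^ |s| := by
            apply mul_le_mul h1.le _ (by positivity) zero_le_one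
            exact Real.rpow_le_rpow_of_exponent_le (by linarith) (le_abs_self s)
        _ ≤ 2 ^ |s| := by
            rw [one_mul]
            exact Real.rpow_le_rpow (by linarith) (by linarith) (abs_nonneg s)
    · rw [indicator_of_notMem hm]; simp
  refine step.trans ?_
  have hp := Real.pi_pos
  rw [Measure.volume_eq_prod, lintegral_prod_mul (f := fun x => F0 (1 - x)) (by fun_prop) (by fun_prop),
    lintegral_sub_left_eq_self F0 1, hF0, hG, lintegral_indicator measurableSet_Ioc,
    lintegral_indicator measurableSet_Ioo, lintegral_const_mul _ (by fun_prop),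
    lint_Ioc (s + 1) δ (by linarith) hδ]
  simp only [lintegral_const, Measure.restrict_apply_univ, Real.volume_Ioo, one_mul]
  have hs1 : 0 < s + 1 := by linarith
  rw [← ENNReal.ofReal_mul (by positivity), ← ENNReal.ofReal_mul (by positivity)]
  apply le_of_eq
  congr 1
  rw [show s + 2 = (s + 1) + 1 by ring, Real.rpow_add hδ (s + 1) 1, Real.rpow_one]
  ring

lemma K1 (s δ : ℝ) (b : ℂ) (hs : -1 < s) (hb : ‖b‖ < 1) (hδ : 0 < δ) :
    ((volume.restrict (ball (0:ℂ) 1)).withDensity (fun w => ENNReal.ofReal ((1 - ‖w‖ ^ 2) ^ s)))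
      {w | ‖1 - conj b * w‖ < δ} ≤
      ENNReal.ofReal (2 ^ |s| * (2 * π / (s + 1)) * δ ^ (s + 2)) := by
  have hT : ∀ a : ℂ, MeasurableSet {w : ℂ | ‖1 - a * w‖ < δ} := fun a =>
    measurableSet_lt (by fun_prop) (by fun_prop)
  rw [withDensity_apply _ (hT _), Measure.restrict_restrict (hT _)]
  refine le_trans (le_of_eq ?_) (K0 s ‖b‖ δ hs (norm_nonneg b) hb hδ)
  have hS : ∀ a : ℂ, MeasurableSet {w : ℂ | ‖w‖ < 1 ∧ ‖1 - a * w‖ < δ} := fun a => mS a δ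
  have hset : {w : ℂ | ‖1 - conj b * w‖ < δ} ∩ ball 0 1 =
      {w : ℂ | ‖w‖ < 1 ∧ ‖1 - conj b * w‖ < δ} := by
    ext w; simp [and_comm]
  rw [hset]
  set e : ℂ ≃ₗᵢ[ℝ] ℂ := rotation (Circle.exp (arg b)) with he
  have hmp : MeasurePreserving e volume volume := e.measurePreserving
  have hbe : ∀ w, conj b * e w = ‖b‖ * w := by
    intro w
    rw [he, rotation_apply, Circle.coe_exp]
    have h1 : b = ‖b‖ * Complex.exp (arg b * I) := (Complex.norm_mul_exp_arg_mul_I b).symm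
    have h2 : Complex.exp (arg b * I) * conj (Complex.exp (arg b * I)) = 1 := by
      rw [Complex.mul_conj, Complex.normSq_eq_norm_sq, Complex.norm_exp_ofReal_mul_I]; simp
    conv_lhs => rw [h1]
    rw [map_mul, Complex.conj_ofReal]
    have h3 : arg (‖b‖ * Complex.exp (arg b * I)) = arg b := by rw [← h1]
    rw [h3]
    linear_combination ‖b‖ * w * h2
  rw [← hmp.setLIntegral_comp_preimage_emb e.toHomeomorph.measurableEmbedding]
  have : e ⁻¹' {w : ℂ | ‖w‖ < 1 ∧ ‖1 - conj b * w‖ < δ} =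
      {w : ℂ | ‖w‖ < 1 ∧ ‖1 - (‖b‖ : ℂ) * w‖ < δ} := by
    ext w; simp only [mem_preimage, mem_ofPred_eq, hbe, e.norm_map]
  rw [this]
  simp only [e.norm_map]

lemma pt (A B D r t : ℝ) (hA : 0 < A) (hB : 0 < B) (hD : 0 < D) (hr : 0 < r) (ht : 0 < t)
    (h : D ≤ A + B) :
    A⁻¹ ^ r * B⁻¹ ^ t ≤ (D / 2)⁻¹ ^ r * B⁻¹ ^ t +
      (D / 2)⁻¹ ^ t * (if A < D / 2 then A⁻¹ ^ r else 0) := by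
  split_ifs with hc
  · have : B⁻¹ ^ t ≤ (D / 2)⁻¹ ^ t :=
      Real.rpow_le_rpow (by positivity) (inv_anti₀ (by positivity) (by linarith)) ht.le
    have h1 : 0 ≤ (D / 2)⁻¹ ^ r * B⁻¹ ^ t := by positivity
    have h2 := mul_le_mul_of_nonneg_right this (show 0 ≤ A⁻¹ ^ r by positivity)
    linarith
  · have : A⁻¹ ^ r ≤ (D / 2)⁻¹ ^ r :=
      Real.rpow_le_rpow (by positivity) (inv_anti₀ (by positivity) (by linarith)) hr.le
    have h2 := mul_le_mul_of_nonneg_right this (show 0 ≤ B⁻¹ ^ t by positivity)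
    linarith

theorem stmt0 (s r t : ℝ) (hs : -1 < s) (hr : 0 < r) (ht : 0 < t)
    (h1 : 2 < r + t - s) (h2 : s + 2 < t) (h3 : r < s + 2) :
    ∃ C > 0, ∀ b ∈ Metric.ball (0:ℂ) 1, ∀ z ∈ Metric.ball (0:ℂ) 1,
      (∫ w in Metric.ball (0:ℂ) 1,
        (1 - ‖w‖^2) ^ s / (‖(1:ℂ) - conj b * w‖ ^ r * ‖(1:ℂ) - conj z * w‖ ^ t))
      ≤ C / (‖(1:ℂ) - conj b * z‖ ^ r * (1 - ‖z‖^2) ^ (t - s - 2)) := by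
  have hp := Real.pi_pos
  have hs1 : 0 < s + 1 := by linarith
  set K : ℝ := 2 ^ |s| * (2 * π / (s + 1)) with hK
  have hK0 : 0 < K := by positivity
  have hta : 0 < t - (s + 2) := by linarith
  have har : 0 < s + 2 - r := by linarith
  set C1 : ℝ := t * K / (t - (s + 2)) with hC1
  set C2 : ℝ := K + r * K / (s + 2 - r) with hC2
  have hC10 : 0 < C1 := by positivity
  have hC20 : 0 < C2 := by positivity
  refine ⟨(2 ^ r * C1 + 2 ^ t * C2) * 2 ^ (t - s - 2), by positivity, ?_⟩
  intro b hb z hz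
  rw [mem_ball_zero_iff] at hb hz
  set D : ℝ := ‖(1:ℂ) - conj b * z‖ with hD
  set h : ℝ := 1 - ‖z‖ with hh
  have hh0 : 0 < h := by linarith
  have hDh : h ≤ D := low b z hb
  have hD0 : 0 < D := by linarith
  set ν : Measure ℂ := (volume.restrict (ball (0:ℂ) 1)).withDensity
    (fun w => ENNReal.ofReal ((1 - ‖w‖ ^ 2) ^ s)) with hν
  set A : ℂ → ℝ := fun w => ‖1 - conj b * w‖ with hA
  set B : ℂ → ℝ := fun w => ‖1 - conj z * w‖ with hB
  have hAm : Measurable A := by fun_prop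
  have hBm : Measurable B := by fun_prop
  have hS : MeasurableSet {w | A w < D / 2} := measurableSet_lt hAm measurable_const
  have hlow : ∀ᵐ w ∂ν, h ≤ B w := by
    refine (withDensity_absolutelyContinuous _ _).ae_le ?_
    filter_upwards [ae_restrict_mem measurableSet_ball] with w hw
    rw [mem_ball_zero_iff] at hw
    have := norm_sub_norm_le (1:ℂ) (conj z * w)
    rw [norm_mul, RCLike.norm_conj, norm_one] at this
    simp only [hB]
    nlinarith [norm_nonneg z]
  have I1 := L1 ν B hBm (fun _ => norm_nonneg _) K (s + 2) t h hK0 ht h2 hh0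
    (fun δ hδ => K1 s δ z hs hz hδ) hlow
  have I2 := L2 ν A hAm (fun _ => norm_nonneg _) K (s + 2) r (D / 2) hK0 hr h3 (by positivity)
    (fun δ hδ => K1 s δ b hs hb hδ)
  set Φ : ℂ → ENNReal := fun w =>
    ENNReal.ofReal ((D / 2)⁻¹ ^ r) * ENNReal.ofReal ((B w)⁻¹ ^ t) +
    ENNReal.ofReal ((D / 2)⁻¹ ^ t) *
      {w | A w < D / 2}.indicator (fun w => ENNReal.ofReal ((A w)⁻¹ ^ r)) w with hΦ
  have hind : Measurable ({w | A w < D / 2}.indicator (fun w => ENNReal.ofReal ((A w)⁻¹ ^ r))) :=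
    Measurable.indicator (by fun_prop) hS
  have hΦm : Measurable Φ := by fun_prop
  have J1 : ∫⁻ w in ball (0:ℂ) 1, ENNReal.ofReal ‖(1 - ‖w‖^2) ^ s /
      (‖(1:ℂ) - conj b * w‖ ^ r * ‖(1:ℂ) - conj z * w‖ ^ t)‖ ≤ ∫⁻ w, Φ w ∂ν := by
    rw [hν, lintegral_withDensity_eq_lintegral_mul _ (by fun_prop) hΦm]
    refine setLIntegral_mono (by fun_prop) ?_
    intro w hw
    rw [mem_ball_zero_iff] at hw
    have hw2 : 0 < 1 - ‖w‖ ^ 2 := by nlinarith [norm_nonneg w]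
    have hA0 : 0 < A w := lt_of_lt_of_le (by linarith) (low b w hb)
    have hB0 : 0 < B w := lt_of_lt_of_le (by linarith) (low z w hz)
    have hpt := pt (A w) (B w) D r t hA0 hB0 hD0 hr ht (tri b z w hb hz hw)
    have e : {w | A w < D / 2}.indicator (fun w => ENNReal.ofReal ((A w)⁻¹ ^ r)) w =
        ENNReal.ofReal (if A w < D / 2 then (A w)⁻¹ ^ r else 0) := by
      by_cases hc : A w < D / 2
      · rw [indicator_of_mem (by exact hc), if_pos hc]
      · rw [indicator_of_notMem (by exact hc), if_neg hc, ENNReal.ofReal_zero]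
    simp only [Pi.mul_apply, hΦ]
    have hif : 0 ≤ (if A w < D / 2 then (A w)⁻¹ ^ r else 0) := by
      split_ifs <;> positivity
    rw [e, ← ENNReal.ofReal_mul (by positivity), ← ENNReal.ofReal_mul (by positivity),
      ← ENNReal.ofReal_add (by positivity) (by positivity), ← ENNReal.ofReal_mul (by positivity)]
    apply ENNReal.ofReal_le_ofReal
    rw [Real.norm_of_nonneg (by positivity), div_eq_mul_inv, mul_inv,
      ← Real.inv_rpow (norm_nonneg _), ← Real.inv_rpow (norm_nonneg _)]
    exact mul_le_mul_of_nonneg_left hpt (by positivity)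
  have J2 : ∫⁻ w, Φ w ∂ν ≤ ENNReal.ofReal ((D / 2)⁻¹ ^ r * (C1 * h ^ (s + 2 - t)) +
      (D / 2)⁻¹ ^ t * (C2 * (D / 2) ^ (s + 2 - r))) := by
    rw [hΦ, lintegral_add_left (by fun_prop), lintegral_const_mul _ (by fun_prop),
      lintegral_const_mul _ hind, lintegral_indicator hS,
      ENNReal.ofReal_add (by positivity) (by positivity),
      ENNReal.ofReal_mul (by positivity), ENNReal.ofReal_mul (p := (D / 2)⁻¹ ^ t) (by positivity)]
    gcongr
  have J3 := norm_integral_le_lintegral_norm (μ := volume.restrict (ball (0:ℂ) 1))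
    (fun w : ℂ => (1 - ‖w‖^2) ^ s / (‖(1:ℂ) - conj b * w‖ ^ r * ‖(1:ℂ) - conj z * w‖ ^ t))
  refine (le_abs_self _).trans (J3.trans ((ENNReal.toReal_le_of_le_ofReal (by positivity)
    (J1.trans J2)).trans ?_))
  have hz2 : 0 < 1 - ‖z‖ ^ 2 := by nlinarith [norm_nonneg z]
  have hzh : (1 - ‖z‖ ^ 2) / 2 ≤ h := by nlinarith [norm_nonneg z]
  have E1 : h ^ (s + 2 - t) ≤ 2 ^ (t - s - 2) / (1 - ‖z‖ ^ 2) ^ (t - s - 2) := by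
    rw [← Real.div_rpow (by norm_num) hz2.le, show s + 2 - t = -(t - s - 2) by ring,
      Real.rpow_neg hh0.le, ← Real.inv_rpow hh0.le]
    apply Real.rpow_le_rpow (by positivity) _ (by linarith)
    rw [← inv_div]
    exact inv_anti₀ (by positivity) hzh
  have E2 : (D / 2)⁻¹ ^ t * (D / 2) ^ (s + 2 - r) ≤ 2 ^ t * D⁻¹ ^ r * h ^ (s + 2 - t) := by
    have e1 : (D / 2)⁻¹ ^ t = 2 ^ t * D ^ (-t) := by
      rw [inv_div, Real.div_rpow (by norm_num) hD0.le, Real.rpow_neg hD0.le]; rfl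
    have e2 : (D / 2) ^ (s + 2 - r) ≤ D ^ (s + 2 - r) :=
      Real.rpow_le_rpow (by positivity) (by linarith) har.le
    have e3 : D ^ (s + 2 - t) ≤ h ^ (s + 2 - t) :=
      Real.rpow_le_rpow_of_nonpos hh0 hDh (by linarith)
    calc (D / 2)⁻¹ ^ t * (D / 2) ^ (s + 2 - r) ≤ 2 ^ t * D ^ (-t) * D ^ (s + 2 - r) := by
          rw [e1]; gcongr
      _ = 2 ^ t * D⁻¹ ^ r * D ^ (s + 2 - t) := by
          rw [Real.inv_rpow hD0.le, ← Real.rpow_neg hD0.le, mul_assoc, mul_assoc,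
            ← Real.rpow_add hD0, ← Real.rpow_add hD0]
          congr 2; ring
      _ ≤ _ := by gcongr
  have e4 : (D / 2)⁻¹ ^ r = 2 ^ r * D⁻¹ ^ r := by
    rw [inv_div, div_eq_mul_inv, Real.mul_rpow (by norm_num) (by positivity)]
  calc (D / 2)⁻¹ ^ r * (C1 * h ^ (s + 2 - t)) + (D / 2)⁻¹ ^ t * (C2 * (D / 2) ^ (s + 2 - r))
      = 2 ^ r * D⁻¹ ^ r * (C1 * h ^ (s + 2 - t)) +
        C2 * ((D / 2)⁻¹ ^ t * (D / 2) ^ (s + 2 - r)) := by rw [e4]; ring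
    _ ≤ 2 ^ r * D⁻¹ ^ r * (C1 * h ^ (s + 2 - t)) +
        C2 * (2 ^ t * D⁻¹ ^ r * h ^ (s + 2 - t)) := by gcongr
    _ = (2 ^ r * C1 + 2 ^ t * C2) * D⁻¹ ^ r * h ^ (s + 2 - t) := by ring
    _ ≤ (2 ^ r * C1 + 2 ^ t * C2) * D⁻¹ ^ r *
        (2 ^ (t - s - 2) / (1 - ‖z‖ ^ 2) ^ (t - s - 2)) := by gcongr
    _ = _ := by
      rw [Real.inv_rpow hD0.le]
      field_simp
end

section
/- Let 1 ≤ p, q < ∞, α > -2, g analytic in the Bloch space ℬ, n ∈ ℕ, 0 ≤ k < n, and c > 0, and set G_c = {z ∈ 𝔻 : |g^{(n-k)}(z)|(1-|z|²)^{n-k} > c}. Suppose there exists C > 0 such that for all f ∈ AT_p^q(α), ∫_𝕋 ( ∫_{Γ(η)} |f^{(k)}|^p |g^{(n-k)}|^p (1-|z|²)^{np+α} dA )^{q/p}|dη| ≥ C ∫_𝕋 ( ∫_{Γ(η)} |f^{(k)}|^p (1-|z|²)^{kp+α} dA )^{q/p}|dη| (i.e. T_g^{n,k} is bounded below modulo polynomials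 of degree < k). Then for all sufficiently small c > 0 there exists C₅ > 0 such that for all f ∈ AT_p^q(α): ∫_𝕋 ( ∫_{Γ(η) ∩ G_c} |f^{(k)}(z)|^p (1-|z|²)^{kp+α} dA(z) )^{q/p} |dη| ≥ C₅ ( ∫_𝕋 ( ∫_{Γ(η)} |f^{(k)}(z)|^p (1-|z|²)^{kp+α} dA(z) )^{q/p} |dη| ). -/
open Complex MeasureTheory Real Set Metric ComplexConjugate ENNReal

/-- Non-tangential region `Γ_ζ(η) = {z ∈ 𝔻 : |z-η| < ζ(1-|z|²)}`. -/
def ntReg (ζ : ℝ) (η : ℂ) : Set ℂ :=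
  {z ∈ Metric.ball (0:ℂ) 1 | ‖z - η‖ < ζ * (1 - ‖z‖^2)}

/-- The tent-space functional `∫_𝕋 (∫_{Γ(η) ∩ G} F dA)^{q/p} |dη|`,
restricted to a set `G`. -/
noncomputable def tentG (p q ζ : ℝ) (G : Set ℂ) (F : ℂ → ℝ) : ℝ≥0∞ :=
  ∫⁻ θ in Set.Ioc (0:ℝ) (2*Real.pi),
    (∫⁻ z in ntReg ζ (Complex.exp (θ * Complex.I)) ∩ G, ENNReal.ofReal (F z)) ^ (q/p)


section maxfun
set_option linter.unusedSectionVars false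
variable {X : Type*} [PseudoMetricSpace X] [SecondCountableTopology X] [MeasurableSpace X]
  [BorelSpace X]

/-- local uncentered maximal function -/
noncomputable def mxf (μ : Measure X) (R0 : ℝ) (φ : X → ℝ≥0∞) (x : X) : ℝ≥0∞ :=
  ⨆ (c : X) (r : ℝ) (_ : 0 < r ∧ r ≤ R0),
    (ball c r).indicator (fun _ => (∫⁻ y in ball c r, φ y ∂μ) / μ (ball c r)) x

lemma mxf_lsc (μ : Measure X) (R0 : ℝ) (φ : X → ℝ≥0∞) : LowerSemicontinuous (mxf μ R0 φ) := by
  unfold mxf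
  refine lowerSemicontinuous_iSup fun c => lowerSemicontinuous_iSup fun r =>
    lowerSemicontinuous_iSup fun _ => ?_
  exact isOpen_ball.lowerSemicontinuous_indicator (zero_le)

lemma mxf_meas (μ : Measure X) (R0 : ℝ) (φ : X → ℝ≥0∞) : Measurable (mxf μ R0 φ) :=
  (mxf_lsc μ R0 φ).measurable

lemma le_mxf (μ : Measure X) (R0 : ℝ) (φ : X → ℝ≥0∞) {x c : X} {r : ℝ} (hr : 0 < r)
    (hR : r ≤ R0) (hx : x ∈ ball c r) :
    (∫⁻ y in ball c r, φ y ∂μ) / μ (ball c r) ≤ mxf μ R0 φ x := by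
  unfold mxf
  refine le_iSup_of_le c (le_iSup_of_le r (le_iSup_of_le ⟨hr, hR⟩ ?_))
  rw [Set.indicator_of_mem hx]

lemma mxf_lt (μ : Measure X) (R0 : ℝ) (φ : X → ℝ≥0∞) {x : X} {l : ℝ≥0∞}
    (h : l < mxf μ R0 φ x) : ∃ (c : X) (r : ℝ), 0 < r ∧ r ≤ R0 ∧ x ∈ ball c r ∧
      l < (∫⁻ y in ball c r, φ y ∂μ) / μ (ball c r) := by
  unfold mxf at h
  simp only [lt_iSup_iff] at h
  obtain ⟨c, r, ⟨h1, h2⟩, h3⟩ := h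
  have hx : x ∈ ball c r := by
    by_contra hx
    rw [Set.indicator_of_notMem hx] at h3
    exact ENNReal.not_lt_zero h3
  rw [Set.indicator_of_mem hx] at h3
  exact ⟨c, r, h1, h2, hx, h3⟩

lemma mxf_add_const (μ : Measure X) (R0 : ℝ) (φ ψ : X → ℝ≥0∞) (l : ℝ≥0∞)
    (h : ∀ x, φ x ≤ ψ x + l) (x : X) : mxf μ R0 φ x ≤ mxf μ R0 ψ x + l := by
  refine le_of_forall_lt fun a ha => ?_
  obtain ⟨c, r, h1, h2, hx, h3⟩ := mxf_lt μ R0 φ ha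
  refine h3.trans_le ?_
  calc _ ≤ (∫⁻ y in ball c r, (ψ y + l) ∂μ) / μ (ball c r) := by
        gcongr; exact h _
    _ ≤ (∫⁻ y in ball c r, ψ y ∂μ) / μ (ball c r) + l := by
        rw [lintegral_add_right _ measurable_const, ENNReal.add_div, setLIntegral_const]
        gcongr
        exact ENNReal.div_le_of_le_mul le_rfl
    _ ≤ _ := by
        gcongr
        exact le_mxf μ R0 ψ h1 h2 hx

lemma mxf_weak (μ : Measure X) [IsFiniteMeasure μ] [μ.IsOpenPosMeasure] (R0 : ℝ) (D : ℝ≥0∞)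
    (hD : ∀ (c : X) (r : ℝ), 0 < r → μ (ball c (5 * r)) ≤ D * μ (ball c r))
    (φ : X → ℝ≥0∞) (l : ℝ≥0∞) :
    l * μ {x | l < mxf μ R0 φ x} ≤ D * ∫⁻ x, φ x ∂μ := by
  set t : Set (X × ℝ) := {b | 0 < b.2 ∧ b.2 ≤ R0 ∧
      l < (∫⁻ y in ball b.1 b.2, φ y ∂μ) / μ (ball b.1 b.2)} with ht
  obtain ⟨u, hut, hdisj, hcov⟩ := Vitali.exists_disjoint_subfamily_covering_enlargement_ball
    t (fun b => b.1) (fun b => b.2) R0 (fun a ha => ha.2.1) 5 (by norm_num)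
  have hcount : u.Countable := by
    refine hdisj.countable_of_isOpen (fun i _ => isOpen_ball) (fun i hi => ?_)
    exact ⟨i.1, mem_ball_self (hut hi).1⟩
  have hsub : {x | l < mxf μ R0 φ x} ⊆ ⋃ b ∈ u, ball b.1 (5 * b.2) := by
    intro x hx
    obtain ⟨c, r, h1, h2, hx, h3⟩ := mxf_lt μ R0 φ hx
    obtain ⟨b, hb, hb'⟩ := hcov (c, r) ⟨h1, h2, h3⟩
    exact mem_iUnion₂.2 ⟨b, hb, hb' hx⟩
  have := hcount.to_subtype
  calc l * μ {x | l < mxf μ R0 φ x} ≤ l * ∑' b : u, μ (ball b.1.1 (5 * b.1.2)) := by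
        gcongr
        exact (measure_mono hsub).trans (measure_biUnion_le μ hcount _)
    _ = ∑' b : u, l * μ (ball b.1.1 (5 * b.1.2)) := ENNReal.tsum_mul_left.symm
    _ ≤ ∑' b : u, D * ∫⁻ y in ball b.1.1 b.1.2, φ y ∂μ := by
        refine ENNReal.tsum_le_tsum fun b => ?_
        obtain ⟨h1, h2, h3⟩ := hut b.2
        calc l * μ (ball b.1.1 (5 * b.1.2)) ≤ l * (D * μ (ball b.1.1 b.1.2)) := by
              gcongr; exact hD _ _ h1
          _ = D * (l * μ (ball b.1.1 b.1.2)) := by ring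
          _ ≤ _ := by
              gcongr
              exact ENNReal.mul_le_of_le_div h3.le
    _ = D * ∑' b : u, ∫⁻ y in ball b.1.1 b.1.2, φ y ∂μ := ENNReal.tsum_mul_left
    _ = D * ∫⁻ y in ⋃ b ∈ u, ball b.1 b.2, φ y ∂μ := by
        rw [lintegral_biUnion hcount (fun _ _ => measurableSet_ball) hdisj]
    _ ≤ _ := by gcongr; exact Measure.restrict_le_self

lemma layer (a : ℝ) (ha : 0 < a) (y : ℝ≥0∞) :
    ∫⁻ l in Ioi (0:ℝ), ENNReal.ofReal (l ^ (a - 1)) * (if ENNReal.ofReal l < y then 1 else 0)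
      = ENNReal.ofReal (1 / a) * y ^ a := by
  have hfin : ∀ b : ℝ, 0 ≤ b → ∫⁻ l in Ioc 0 b, ENNReal.ofReal (l ^ (a - 1))
      = ENNReal.ofReal (1 / a) * ENNReal.ofReal b ^ a := by
    intro b hb
    rw [← ofReal_integral_eq_lintegral_ofReal]
    · rw [← intervalIntegral.integral_of_le hb, integral_rpow (Or.inl (by linarith)),
        ENNReal.ofReal_rpow_of_nonneg hb ha.le, ← ENNReal.ofReal_mul (by positivity)]
      congr 1
      simp [Real.zero_rpow ha.ne']
      field_simp
    · exact (intervalIntegrable_iff_integrableOn_Ioc_of_le hb).1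
        (intervalIntegral.intervalIntegrable_rpow' (by linarith))
    · filter_upwards [ae_restrict_mem measurableSet_Ioc] with l hl
      exact Real.rpow_nonneg hl.1.le _
  by_cases hy : y = ⊤
  · subst hy
    rw [ENNReal.top_rpow_of_pos ha, ENNReal.mul_top (by simpa using ha)]
    simp only [ENNReal.ofReal_lt_top, if_true, mul_one]
    refine ENNReal.eq_top_of_forall_nnreal_le fun r => ?_
    have h1 := hfin ((a * r) ^ (1 / a)) (by positivity)
    rw [ENNReal.ofReal_rpow_of_nonneg (by positivity) ha.le, ← ENNReal.ofReal_mul (by positivity),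
      ← Real.rpow_mul (by positivity), one_div_mul_cancel ha.ne', Real.rpow_one,
      ← mul_assoc, one_div_mul_cancel ha.ne', one_mul, ENNReal.ofReal_coe_nnreal] at h1
    rw [← h1]
    exact lintegral_mono_set Ioc_subset_Ioi_self
  · lift y to NNReal using hy
    rw [← ENNReal.ofReal_coe_nnreal, ← hfin y y.2]
    have : ∀ l ∈ Ioi (0:ℝ), ENNReal.ofReal (l ^ (a - 1)) *
        (if ENNReal.ofReal l < ENNReal.ofReal (y:ℝ) then 1 else 0)
        = (Ioo (0:ℝ) y).indicator (fun l => ENNReal.ofReal (l ^ (a - 1))) l := by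
      intro l hl
      have hl' : (0:ℝ) < l := hl
      by_cases h : l < (y:ℝ)
      · rw [Set.indicator_of_mem (show l ∈ Ioo (0:ℝ) y from ⟨hl, h⟩), if_pos, mul_one]
        exact (ENNReal.ofReal_lt_ofReal_iff (hl'.trans h)).2 h
      · rw [Set.indicator_of_notMem (fun h' => h h'.2), if_neg, mul_zero]
        exact not_lt.2 (ENNReal.ofReal_le_ofReal (not_lt.1 h))
    rw [setLIntegral_congr_fun measurableSet_Ioi this, lintegral_indicator measurableSet_Ioo,
      Measure.restrict_restrict measurableSet_Ioo, inter_eq_left.2 Ioo_subset_Ioi_self]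
    exact setLIntegral_congr Ioo_ae_eq_Ioc

lemma mxf_strong (μ : Measure X) [IsFiniteMeasure μ] [μ.IsOpenPosMeasure] (R0 : ℝ) (D : ℝ≥0∞)
    (hD : ∀ (c : X) (r : ℝ), 0 < r → μ (ball c (5 * r)) ≤ D * μ (ball c r))
    (t : ℝ) (ht : 1 < t) (φ : X → ℝ≥0∞) (hφ : Measurable φ) :
    ∫⁻ x, (mxf μ R0 φ x) ^ t ∂μ ≤
      ENNReal.ofReal t * (2 * D * (2 ^ (t - 1) * ENNReal.ofReal (1 / (t - 1)))) *
        ∫⁻ x, φ x ^ t ∂μ := by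
  have hM := mxf_meas μ R0 φ
  have e1 : ∀ y : ℝ≥0∞, y ^ t = ENNReal.ofReal t * ∫⁻ l in Ioi (0:ℝ),
      ENNReal.ofReal (l ^ (t - 1)) * (if ENNReal.ofReal l < y then 1 else 0) := by
    intro y
    rw [layer t (by linarith), ← mul_assoc, ← ENNReal.ofReal_mul (by linarith),
      mul_one_div_cancel (by linarith), ENNReal.ofReal_one, one_mul]
  have hmeas1 : ∀ ψ : X → ℝ≥0∞, Measurable ψ → Measurable (Function.uncurry fun (x : X) (l : ℝ) =>
      ENNReal.ofReal (l ^ (t - 1)) * (if ENNReal.ofReal l < ψ x then (1:ℝ≥0∞) else 0)) := by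
    intro ψ hψ
    refine Measurable.mul (by fun_prop) (Measurable.ite ?_ measurable_const measurable_const)
    exact measurableSet_lt (by fun_prop) (by fun_prop)
  have hmeas2 : Measurable (Function.uncurry fun (x : X) (l : ℝ) =>
      ENNReal.ofReal (l ^ (t - 1 - 1)) * (if ENNReal.ofReal l < 2 * φ x then φ x else 0)) := by
    refine Measurable.mul (by fun_prop) (Measurable.ite ?_ (by fun_prop) measurable_const)
    exact measurableSet_lt (by fun_prop) (by fun_prop)
  have key : ∀ l : ℝ, 0 < l → μ {x | ENNReal.ofReal l < mxf μ R0 φ x} ≤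
      2 * D * ENNReal.ofReal (l⁻¹) * ∫⁻ x, (if ENNReal.ofReal l < 2 * φ x then φ x else 0) ∂μ := by
    intro l hl
    set ψ : X → ℝ≥0∞ := fun x => if ENNReal.ofReal l < 2 * φ x then φ x else 0
    have h1 : ∀ x, φ x ≤ ψ x + ENNReal.ofReal (l / 2) := by
      intro x
      by_cases h : ENNReal.ofReal l < 2 * φ x
      · simp [ψ, h]
      · simp only [ψ, h, if_false, zero_add]
        rw [ENNReal.ofReal_div_of_pos (by norm_num), ENNReal.le_div_iff_mul_le (by simp) (by simp)]
        rw [mul_comm]; simpa using h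
    have h2 : {x | ENNReal.ofReal l < mxf μ R0 φ x} ⊆
        {x | ENNReal.ofReal (l / 2) < mxf μ R0 ψ x} := by
      intro x hx
      have h3 := lt_of_lt_of_le hx (mxf_add_const μ R0 φ ψ _ h1 x)
      by_contra h4
      simp only [mem_ofPred_eq, not_lt] at h4
      refine absurd h3 (not_lt.2 ?_)
      calc _ ≤ ENNReal.ofReal (l / 2) + ENNReal.ofReal (l / 2) := by gcongr
        _ = _ := by rw [← ENNReal.ofReal_add (by positivity) (by positivity)]; congr 1; ring
    have h5 := mxf_weak μ R0 D hD ψ (ENNReal.ofReal (l / 2))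
    calc μ {x | ENNReal.ofReal l < mxf μ R0 φ x}
        ≤ μ {x | ENNReal.ofReal (l / 2) < mxf μ R0 ψ x} := measure_mono h2
      _ = (2 * ENNReal.ofReal l⁻¹) * (ENNReal.ofReal (l / 2) *
            μ {x | ENNReal.ofReal (l / 2) < mxf μ R0 ψ x}) := by
          have : 2 * ENNReal.ofReal l⁻¹ * ENNReal.ofReal (l / 2) = 1 := by
            rw [show (2:ℝ≥0∞) = ENNReal.ofReal 2 by simp, ← ENNReal.ofReal_mul (by norm_num),
              ← ENNReal.ofReal_mul (by positivity)]
            rw [show 2 * l⁻¹ * (l / 2) = 1 by field_simp]; simp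
          rw [← mul_assoc, this, one_mul]
      _ ≤ (2 * ENNReal.ofReal l⁻¹) * (D * ∫⁻ x, ψ x ∂μ) := by gcongr
      _ = _ := by ring
  calc ∫⁻ x, (mxf μ R0 φ x) ^ t ∂μ
      = ENNReal.ofReal t * ∫⁻ x, (∫⁻ l in Ioi (0:ℝ), ENNReal.ofReal (l ^ (t - 1)) *
          (if ENNReal.ofReal l < mxf μ R0 φ x then 1 else 0)) ∂μ := by
        simp_rw [e1]
        rw [lintegral_const_mul' _ _ (by simp)]
    _ = ENNReal.ofReal t * ∫⁻ l in Ioi (0:ℝ), ∫⁻ x, ENNReal.ofReal (l ^ (t - 1)) *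
          (if ENNReal.ofReal l < mxf μ R0 φ x then 1 else 0) ∂μ := by
        rw [lintegral_lintegral_swap (hmeas1 _ hM).aemeasurable]
    _ ≤ ENNReal.ofReal t * ∫⁻ l in Ioi (0:ℝ), 2 * D * ∫⁻ x, ENNReal.ofReal (l ^ (t - 1 - 1)) *
          (if ENNReal.ofReal l < 2 * φ x then φ x else 0) ∂μ := by
        gcongr 1
        refine setLIntegral_mono' measurableSet_Ioi fun l hl => ?_
        have hl' : (0:ℝ) < l := hl
        rw [lintegral_const_mul' _ _ (by simp), lintegral_const_mul' _ _ (by simp)]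
        have : ∫⁻ x, (if ENNReal.ofReal l < mxf μ R0 φ x then (1:ℝ≥0∞) else 0) ∂μ =
            μ {x | ENNReal.ofReal l < mxf μ R0 φ x} := by
          rw [← lintegral_indicator_one (measurableSet_lt measurable_const hM)]
          refine lintegral_congr fun x => ?_
          by_cases h : ENNReal.ofReal l < mxf μ R0 φ x
          · rw [if_pos h, Set.indicator_of_mem (by exact h)]; rfl
          · rw [if_neg h, Set.indicator_of_notMem (by exact h)]
        rw [this]
        refine (mul_le_mul_right (key l hl') _).trans_eq ?_
        rw [Real.rpow_sub_one hl'.ne' (t - 1), div_eq_mul_inv, ENNReal.ofReal_mul (by positivity)]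
        ring
    _ = ENNReal.ofReal t * (2 * D * ∫⁻ l in Ioi (0:ℝ), ∫⁻ x, ENNReal.ofReal (l ^ (t - 1 - 1)) *
          (if ENNReal.ofReal l < 2 * φ x then φ x else 0) ∂μ) := by
        rw [lintegral_const_mul]
        exact (hmeas2.comp measurable_swap).lintegral_prod_right'
    _ = ENNReal.ofReal t * (2 * D * ∫⁻ x, (∫⁻ l in Ioi (0:ℝ), ENNReal.ofReal (l ^ (t - 1 - 1)) *
          (if ENNReal.ofReal l < 2 * φ x then φ x else 0)) ∂μ) := by
        rw [lintegral_lintegral_swap hmeas2.aemeasurable]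
    _ = ENNReal.ofReal t * (2 * D * ∫⁻ x, (2 ^ (t - 1) * ENNReal.ofReal (1 / (t - 1))) *
          φ x ^ t ∂μ) := by
        congr 2
        refine lintegral_congr fun x => ?_
        have : ∀ l : ℝ, ENNReal.ofReal (l ^ (t - 1 - 1)) *
          (if ENNReal.ofReal l < 2 * φ x then φ x else 0) = φ x * (ENNReal.ofReal (l ^ (t - 1 - 1)) *
          (if ENNReal.ofReal l < 2 * φ x then 1 else 0)) := by
          intro l; split_ifs <;> ring
        simp_rw [this]
        rw [lintegral_const_mul, layer _ (by linarith), ENNReal.mul_rpow_of_nonneg _ _ (by linarith)]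
        · have : φ x ^ t = φ x * φ x ^ (t - 1) := by
            conv_lhs => rw [show t = 1 + (t - 1) by ring]
            rw [ENNReal.rpow_add_of_nonneg _ _ (by norm_num) (by linarith), ENNReal.rpow_one]
          rw [this]; ring
        · refine Measurable.mul (by fun_prop) (Measurable.ite ?_ measurable_const measurable_const)
          exact measurableSet_lt (by fun_prop) (by fun_prop)
    _ = _ := by
        rw [lintegral_const_mul _ (hφ.pow_const t)]; ring

end maxfun

section aperture
set_option linter.unusedSectionVars false
variable {X : Type*} [PseudoMetricSpace X] [SecondCountableTopology X] [MeasurableSpace X]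
  [BorelSpace X] {Y : Type*} [MeasurableSpace Y]

lemma meas_rel (c : Y → X) (ρ : Y → ℝ) (hc : Measurable c) (hρ : Measurable ρ) :
    MeasurableSet {a : X × Y | a.1 ∈ ball (c a.2) (ρ a.2)} := by
  simp only [mem_ball]
  exact measurableSet_lt (by fun_prop) (by fun_prop)

lemma meas_cnt (ν : Measure Y) [SFinite ν] (c : Y → X) (ρ : Y → ℝ)
    (hc : Measurable c) (hρ : Measurable ρ) :
    Measurable (fun x => ν {y | x ∈ ball (c y) (ρ y)}) :=
  measurable_measure_prodMk_left (meas_rel c ρ hc hρ)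

lemma fub (μ : Measure X) [IsFiniteMeasure μ] (ν : Measure Y) [SFinite ν] (c : Y → X) (ρ : Y → ℝ)
    (hc : Measurable c) (hρ : Measurable ρ) (φ : X → ℝ≥0∞) (hφ : Measurable φ) :
    ∫⁻ x, ν {y | x ∈ ball (c y) (ρ y)} * φ x ∂μ
      = ∫⁻ y, (∫⁻ x in ball (c y) (ρ y), φ x ∂μ) ∂ν := by
  set S : Set (X × Y) := {a : X × Y | a.1 ∈ ball (c a.2) (ρ a.2)}
  have hS : MeasurableSet S := meas_rel c ρ hc hρ
  have h1 : ∀ x, ν {y | x ∈ ball (c y) (ρ y)} * φ x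
      = ∫⁻ y, S.indicator (fun a => φ a.1) (x, y) ∂ν := by
    intro x
    have hSx : MeasurableSet {y | x ∈ ball (c y) (ρ y)} := measurable_prodMk_left hS
    have : ∀ y, S.indicator (fun a => φ a.1) (x, y) =
        {y | x ∈ ball (c y) (ρ y)}.indicator (fun _ => φ x) y := fun y => rfl
    simp_rw [this]
    rw [lintegral_indicator hSx, setLIntegral_const, mul_comm]
  have h2 : ∀ y, (∫⁻ x in ball (c y) (ρ y), φ x ∂μ)
      = ∫⁻ x, S.indicator (fun a => φ a.1) (x, y) ∂μ := by
    intro y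
    rw [← lintegral_indicator measurableSet_ball]
    rfl
  simp_rw [h1, h2]
  exact lintegral_lintegral_swap (((hφ.comp measurable_fst).indicator hS)).aemeasurable

lemma ball_max (μ : Measure X) [IsFiniteMeasure μ] [μ.IsOpenPosMeasure] (R : ℝ) (hR : 1 ≤ R)
    (D : ℝ≥0∞) (hDR : ∀ (c : X) (r : ℝ), 0 < r → μ (ball c (R * r)) ≤ D * μ (ball c r))
    (φ : X → ℝ≥0∞) (c : X) (r : ℝ) (hr : 0 < r) (hr1 : r ≤ 1) :
    ∫⁻ x in ball c (R * r), φ x ∂μ ≤ D * ∫⁻ x in ball c r, mxf μ R φ x ∂μ := by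
  have hRr : 0 < R * r := by positivity
  have h0 : μ (ball c (R * r)) ≠ 0 := (measure_ball_pos μ c hRr).ne'
  set J := ∫⁻ x in ball c (R * r), φ x ∂μ with hJ
  calc J = J / μ (ball c (R * r)) * μ (ball c (R * r)) :=
        (ENNReal.div_mul_cancel h0 (measure_ne_top _ _)).symm
    _ ≤ J / μ (ball c (R * r)) * (D * μ (ball c r)) := by gcongr; exact hDR c r hr
    _ = D * ∫⁻ x in ball c r, J / μ (ball c (R * r)) ∂μ := by rw [setLIntegral_const]; ring
    _ ≤ _ := by
        gcongr 1
        refine setLIntegral_mono' measurableSet_ball fun x hx => ?_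
        exact le_mxf μ R φ hRr (by nlinarith) (ball_subset_ball (by nlinarith) hx)

lemma aper_gt (μ : Measure X) [IsFiniteMeasure μ] [μ.IsOpenPosMeasure] (R : ℝ) (hR : 1 ≤ R)
    (D : ℝ≥0∞) (hDtop : D ≠ ⊤)
    (hD : ∀ (c : X) (r : ℝ), 0 < r → μ (ball c (5 * r)) ≤ D * μ (ball c r))
    (hDR : ∀ (c : X) (r : ℝ), 0 < r → μ (ball c (R * r)) ≤ D * μ (ball c r))
    (ν : Measure Y) [SFinite ν] (c : Y → X) (r : Y → ℝ) (hc : Measurable c) (hr : Measurable r)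
    (hrp : ∀ᵐ y ∂ν, 0 < r y ∧ r y ≤ 1) (s : ℝ) (hs : 1 < s)
    (hA : ∫⁻ x, ν {y | x ∈ ball (c y) (r y)} ^ s ∂μ ≠ ⊤) :
    ∫⁻ x, ν {y | x ∈ ball (c y) (R * r y)} ^ s ∂μ ≠ ⊤ := by
  set A : X → ℝ≥0∞ := fun x => ν {y | x ∈ ball (c y) (r y)} with hAdef
  set A' : X → ℝ≥0∞ := fun x => ν {y | x ∈ ball (c y) (R * r y)} with hA'def
  have hAm : Measurable A := meas_cnt ν c r hc hr
  have hA'm : Measurable A' := meas_cnt ν c _ hc (hr.const_mul R)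
  have hs0 : 0 < s := by linarith
  have hconj : s.HolderConjugate (s / (s - 1)) := Real.HolderConjugate.conjExponent hs
  set s' := s / (s - 1) with hs'
  have hs'1 : 1 < s' := hconj.symm.lt
  set K : ℝ≥0∞ := ENNReal.ofReal s' * (2 * D * (2 ^ (s' - 1) * ENNReal.ofReal (1 / (s' - 1))))
    with hK
  have hKtop : K ≠ ⊤ := by
    refine ENNReal.mul_ne_top (by simp) (ENNReal.mul_ne_top (ENNReal.mul_ne_top (by simp) hDtop)
      (ENNReal.mul_ne_top (ENNReal.rpow_ne_top_of_nonneg (by linarith) (by simp)) (by simp)))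
  set Q : ℝ≥0∞ := D * (∫⁻ x, A x ^ s ∂μ) ^ (1 / s) * K ^ (1 / s') with hQ
  have hQtop : Q ≠ ⊤ := by
    refine ENNReal.mul_ne_top (ENNReal.mul_ne_top hDtop
      (ENNReal.rpow_ne_top_of_nonneg (by positivity) hA))
      (ENNReal.rpow_ne_top_of_nonneg (by positivity) hKtop)
  have bound : ∀ N : ℕ, ∫⁻ x, (min (A' x) N) ^ s ∂μ ≤ Q ^ s := by
    intro N
    set a : X → ℝ≥0∞ := fun x => min (A' x) N with ha
    have ham : Measurable a := hA'm.min measurable_const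
    set I := ∫⁻ x, a x ^ s ∂μ with hI
    have hItop : I ≠ ⊤ := by
      refine ne_top_of_le_ne_top ?_ (lintegral_mono (g := fun _ => (N:ℝ≥0∞) ^ s) fun x => ?_)
      · rw [lintegral_const]
        exact ENNReal.mul_ne_top (ENNReal.rpow_ne_top_of_nonneg hs0.le (by simp))
          (measure_ne_top _ _)
      · exact ENNReal.rpow_le_rpow (min_le_right _ _) hs0.le
    have hφm : Measurable (fun x => a x ^ (s - 1)) := ham.pow_const _
    have h1 : I ≤ Q * I ^ (1 / s') := by
      calc I = ∫⁻ x, a x * a x ^ (s - 1) ∂μ := by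
            refine lintegral_congr fun x => ?_
            conv_lhs => rw [show s = 1 + (s - 1) by ring]
            rw [ENNReal.rpow_add_of_nonneg _ _ (by norm_num) (by linarith), ENNReal.rpow_one]
        _ ≤ ∫⁻ x, A' x * a x ^ (s - 1) ∂μ := by
            gcongr with x
            exact min_le_left _ _
        _ = ∫⁻ y, (∫⁻ x in ball (c y) (R * r y), a x ^ (s - 1) ∂μ) ∂ν :=
            fub μ ν c _ hc (hr.const_mul R) _ hφm
        _ ≤ ∫⁻ y, D * (∫⁻ x in ball (c y) (r y), mxf μ R (fun x => a x ^ (s - 1)) x ∂μ) ∂ν := by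
            refine lintegral_mono_ae ?_
            filter_upwards [hrp] with y hy
            exact ball_max μ R hR D hDR _ _ _ hy.1 hy.2
        _ = D * ∫⁻ y, (∫⁻ x in ball (c y) (r y), mxf μ R (fun x => a x ^ (s - 1)) x ∂μ) ∂ν :=
            lintegral_const_mul' _ _ hDtop
        _ = D * ∫⁻ x, A x * mxf μ R (fun x => a x ^ (s - 1)) x ∂μ := by
            rw [fub μ ν c r hc hr _ (mxf_meas _ _ _)]
        _ ≤ D * ((∫⁻ x, A x ^ s ∂μ) ^ (1 / s) *
              (∫⁻ x, mxf μ R (fun x => a x ^ (s - 1)) x ^ s' ∂μ) ^ (1 / s')) := by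
            gcongr
            exact ENNReal.lintegral_mul_le_Lp_mul_Lq μ hconj hAm.aemeasurable
              (mxf_meas _ _ _).aemeasurable
        _ ≤ D * ((∫⁻ x, A x ^ s ∂μ) ^ (1 / s) * (K * I) ^ (1 / s')) := by
            gcongr
            refine (mxf_strong μ R D hD s' hs'1 _ hφm).trans_eq ?_
            congr 1
            refine lintegral_congr fun x => ?_
            rw [← ENNReal.rpow_mul, hs']
            congr 1
            field_simp [show s - 1 ≠ 0 by linarith]
        _ = Q * I ^ (1 / s') := by
            rw [ENNReal.mul_rpow_of_nonneg _ _ (by positivity), hQ]; ring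
    by_cases hI0 : I = 0
    · rw [hI0]; exact zero_le
    have h2 : I ^ (1 / s) ≤ Q := by
      have e : I = I ^ (1 / s) * I ^ (1 / s') := by
        rw [← ENNReal.rpow_add _ _ hI0 hItop, one_div, one_div, hconj.inv_add_inv_eq_one,
          ENNReal.rpow_one]
      rw [e] at h1
      have hne : I ^ (1 / s') ≠ 0 := by
        simp [ENNReal.rpow_eq_zero_iff, hI0, hItop]
      have hnt : I ^ (1 / s') ≠ ⊤ := ENNReal.rpow_ne_top_of_nonneg (by positivity) hItop
      rw [← e] at h1
      conv at h1 => lhs; rw [e]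
      exact (ENNReal.mul_le_mul_iff_left hne hnt).1 h1
    calc I = (I ^ (1 / s)) ^ s := by
          rw [← ENNReal.rpow_mul, one_div_mul_cancel hs0.ne', ENNReal.rpow_one]
      _ ≤ Q ^ s := ENNReal.rpow_le_rpow h2 hs0.le
  have hsup : ∀ x, A' x ^ s ≤ ⨆ N : ℕ, (min (A' x) N) ^ s := by
    intro x
    have ht : Filter.Tendsto (fun N : ℕ => (min (A' x) (N:ℝ≥0∞)) ^ s) Filter.atTop
        (nhds ((min (A' x) ⊤) ^ s)) := by
      refine (ENNReal.continuous_rpow_const.tendsto _).comp ?_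
      exact tendsto_const_nhds.min ENNReal.tendsto_nat_nhds_top
    rw [min_top_right] at ht
    exact le_of_tendsto' ht fun N => le_iSup (fun N : ℕ => (min (A' x) (N:ℝ≥0∞)) ^ s) N
  refine ne_top_of_le_ne_top (ENNReal.rpow_ne_top_of_nonneg hs0.le hQtop : Q ^ s ≠ ⊤) ?_
  calc ∫⁻ x, A' x ^ s ∂μ ≤ ∫⁻ x, ⨆ N : ℕ, (min (A' x) N) ^ s ∂μ := lintegral_mono hsup
    _ = ⨆ N : ℕ, ∫⁻ x, (min (A' x) N) ^ s ∂μ := by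
        refine lintegral_iSup (fun N => (hA'm.min measurable_const).pow_const _) ?_
        intro N M hNM x
        have : (N:ℝ≥0∞) ≤ M := by exact_mod_cast hNM
        dsimp only
        gcongr
    _ ≤ Q ^ s := iSup_le bound

lemma aper_one (μ : Measure X) [IsFiniteMeasure μ] [μ.IsOpenPosMeasure] (R : ℝ)
    (D : ℝ≥0∞) (hDtop : D ≠ ⊤)
    (hDR : ∀ (c : X) (r : ℝ), 0 < r → μ (ball c (R * r)) ≤ D * μ (ball c r))
    (ν : Measure Y) [SFinite ν] (c : Y → X) (r : Y → ℝ) (hc : Measurable c) (hr : Measurable r)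
    (hrp : ∀ᵐ y ∂ν, 0 < r y ∧ r y ≤ 1)
    (hA : ∫⁻ x, ν {y | x ∈ ball (c y) (r y)} ∂μ ≠ ⊤) :
    ∫⁻ x, ν {y | x ∈ ball (c y) (R * r y)} ∂μ ≠ ⊤ := by
  have h1 := fub μ ν c r hc hr (fun _ => 1) measurable_const
  have h2 := fub μ ν c _ hc (hr.const_mul R) (fun _ => 1) measurable_const
  simp only [mul_one, lintegral_one, Measure.restrict_apply_univ] at h1 h2
  rw [h2]
  rw [h1] at hA
  refine ne_top_of_le_ne_top (ENNReal.mul_ne_top hDtop hA) ?_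
  rw [← lintegral_const_mul' _ _ hDtop]
  refine lintegral_mono_ae ?_
  filter_upwards [hrp] with y hy
  exact hDR _ _ hy.1

lemma jens (P : Measure X) [IsProbabilityMeasure P] (u : X → ℝ≥0∞) (hu : Measurable u)
    (hu1 : ∀ x, 1 ≤ u x) (hut : ∀ᵐ x ∂P, u x ≠ ⊤) (δ κ : ℝ) (hδ : 0 < δ) (hκ : 0 < κ) :
    (∫⁻ x, u x ^ δ ∂P) ^ (-κ) ≤ ∫⁻ x, u x ^ (-(δ * κ)) ∂P := by
  set m := ∫⁻ x, u x ^ δ ∂P with hm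
  set v := ∫⁻ x, u x ^ (-(δ * κ)) ∂P with hv
  have hconj : ((1 + κ) / κ).HolderConjugate (1 + κ) := by
    rw [Real.holderConjugate_iff]
    constructor
    · rw [lt_div_iff₀ hκ]; linarith
    · field_simp; ring
  have h1 : 1 ≤ m ^ (1 / ((1 + κ) / κ)) * v ^ (1 / (1 + κ)) := by
    calc (1:ℝ≥0∞) = ∫⁻ x, 1 ∂P := by simp
      _ = ∫⁻ x, ((fun x => u x ^ (δ * κ / (1 + κ))) * (fun x => u x ^ (-(δ * κ / (1 + κ))))) x ∂P := by
          refine lintegral_congr_ae ?_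
          filter_upwards [hut] with x hx
          simp only [Pi.mul_apply]
          rw [← ENNReal.rpow_add _ _ (by have := hu1 x; positivity) hx]
          simp
      _ ≤ _ := ENNReal.lintegral_mul_le_Lp_mul_Lq P hconj (hu.pow_const _).aemeasurable
            (hu.pow_const _).aemeasurable
      _ = _ := by
          simp only [← ENNReal.rpow_mul]
          rw [hm, hv]
          congr 3
          · funext x
            congr 1; field_simp
          · funext x
            congr 1; field_simp
  have h2 : 1 ≤ m ^ κ * v := by
    have := ENNReal.rpow_le_rpow h1 (show 0 ≤ 1 + κ by linarith)
    rw [ENNReal.one_rpow, ENNReal.mul_rpow_of_nonneg _ _ (by linarith), ← ENNReal.rpow_mul,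
      ← ENNReal.rpow_mul] at this
    rwa [show 1 / ((1 + κ) / κ) * (1 + κ) = κ by field_simp, one_div_mul_cancel (by linarith),
      ENNReal.rpow_one] at this
  rw [ENNReal.rpow_neg]
  rw [ENNReal.inv_le_iff_le_mul (fun h h' => by
    rw [h, h'] at h2; simp at h2) (fun h h' => by
    rw [h, h'] at h2; simp at h2)]
  exact h2

lemma wt_bound (μ : Measure X) [IsFiniteMeasure μ] [μ.IsOpenPosMeasure] (R : ℝ) (hR : 1 ≤ R)
    (D : ℝ≥0∞) (hDtop : D ≠ ⊤) (hD1 : 1 ≤ D)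
    (hDR : ∀ (c : X) (r : ℝ), 0 < r → μ (ball c (R * r)) ≤ D * μ (ball c r))
    (u : X → ℝ≥0∞) (hu : Measurable u)
    (hu1 : ∀ x, 1 ≤ u x) (hut : ∀ᵐ x ∂μ, u x ≠ ⊤) (δ κ : ℝ) (hδ : 0 < δ) (hκ : 0 < κ)
    (c : X) (r : ℝ) (hr : 0 < r) (hr1 : r ≤ 1) :
    ∫⁻ x in ball c (R * r), (mxf μ R (fun x => u x ^ δ) x) ^ (-κ) ∂μ ≤
      D * D ^ κ * ∫⁻ x in ball c r, u x ^ (-(δ * κ)) ∂μ := by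
  have hRr : 0 < R * r := by positivity
  have hB0 : μ (ball c r) ≠ 0 := (measure_ball_pos μ c hr).ne'
  have hBt : μ (ball c r) ≠ ⊤ := measure_ne_top _ _
  have hD0 : D ≠ 0 := (lt_of_lt_of_le one_pos hD1).ne'
  set P : Measure X := (μ (ball c r))⁻¹ • μ.restrict (ball c r) with hP
  have hPp : IsProbabilityMeasure P := ⟨by
    rw [hP]; simp [ENNReal.inv_mul_cancel hB0 hBt]⟩
  have hutP : ∀ᵐ x ∂P, u x ≠ ⊤ := by
    have h1 : ∀ᵐ x ∂(μ.restrict (ball c r)), u x ≠ ⊤ := ae_restrict_of_ae hut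
    exact Measure.ae_smul_measure h1 _
  have hj := jens P u hu hu1 hutP δ κ hδ hκ
  set m := ∫⁻ x, u x ^ δ ∂P with hm
  have hm1 : 1 ≤ m := by
    calc (1:ℝ≥0∞) = ∫⁻ x, 1 ∂P := by simp
      _ ≤ _ := lintegral_mono fun x => ENNReal.one_le_rpow (hu1 x) hδ
  have hm' : m = (μ (ball c r))⁻¹ * ∫⁻ x in ball c r, u x ^ δ ∂μ := by
    rw [hm, hP, lintegral_smul_measure, smul_eq_mul]
  have hpt : ∀ x ∈ ball c (R * r), (mxf μ R (fun x => u x ^ δ) x) ^ (-κ) ≤ D ^ κ * m ^ (-κ) := by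
    intro x hx
    have h1 : D⁻¹ * m ≤ mxf μ R (fun x => u x ^ δ) x := by
      refine le_trans ?_ (le_mxf μ R (fun x => u x ^ δ) hRr (by nlinarith) hx)
      rw [hm', ← mul_assoc, ← ENNReal.mul_inv (Or.inl hD0) (Or.inl hDtop), ENNReal.div_eq_inv_mul]
      gcongr ?_ * ?_
      · exact ENNReal.inv_le_inv.2 (hDR c r hr)
      · exact lintegral_mono_set (ball_subset_ball (by nlinarith))
    have h2 : (D⁻¹ * m) ^ (-κ) = D ^ κ * m ^ (-κ) := by
      rw [ENNReal.mul_rpow_of_ne_zero (ENNReal.inv_ne_zero.2 hDtop)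
        (lt_of_lt_of_le one_pos hm1).ne', ENNReal.inv_rpow, ENNReal.rpow_neg D, inv_inv]
    rw [← h2, ENNReal.rpow_neg, ENNReal.rpow_neg]
    exact ENNReal.inv_le_inv.2 (ENNReal.rpow_le_rpow h1 hκ.le)
  calc _ ≤ ∫⁻ x in ball c (R * r), D ^ κ * m ^ (-κ) ∂μ :=
        setLIntegral_mono' measurableSet_ball hpt
    _ = D ^ κ * m ^ (-κ) * μ (ball c (R * r)) := setLIntegral_const _ _
    _ ≤ D ^ κ * (∫⁻ x, u x ^ (-(δ * κ)) ∂P) * (D * μ (ball c r)) := by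
        gcongr; exact hDR c r hr
    _ = D * D ^ κ * ((μ (ball c r))⁻¹ * μ (ball c r)) *
          ∫⁻ x in ball c r, u x ^ (-(δ * κ)) ∂μ := by
        rw [hP, lintegral_smul_measure, smul_eq_mul]; ring
    _ = _ := by rw [ENNReal.inv_mul_cancel hB0 hBt, mul_one]

lemma aper_lt (μ : Measure X) [IsFiniteMeasure μ] [μ.IsOpenPosMeasure] (R : ℝ) (hR : 1 ≤ R)
    (D : ℝ≥0∞) (hDtop : D ≠ ⊤) (hD1 : 1 ≤ D)
    (hD : ∀ (c : X) (r : ℝ), 0 < r → μ (ball c (5 * r)) ≤ D * μ (ball c r))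
    (hDR : ∀ (c : X) (r : ℝ), 0 < r → μ (ball c (R * r)) ≤ D * μ (ball c r))
    (ν : Measure Y) [SFinite ν] (c : Y → X) (r : Y → ℝ) (hc : Measurable c) (hr : Measurable r)
    (hrp : ∀ᵐ y ∂ν, 0 < r y ∧ r y ≤ 1) (s : ℝ) (hs0 : 0 < s) (hs : s < 1)
    (hA : ∫⁻ x, ν {y | x ∈ ball (c y) (r y)} ^ s ∂μ ≠ ⊤) :
    ∫⁻ x, ν {y | x ∈ ball (c y) (R * r y)} ^ s ∂μ ≠ ⊤ := by
  set A : X → ℝ≥0∞ := fun x => ν {y | x ∈ ball (c y) (r y)} with hAdef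
  set A' : X → ℝ≥0∞ := fun x => ν {y | x ∈ ball (c y) (R * r y)} with hA'def
  have hAm : Measurable A := meas_cnt ν c r hc hr
  have hA'm : Measurable A' := meas_cnt ν c _ hc (hr.const_mul R)
  set u : X → ℝ≥0∞ := fun x => A x + 1 with hu
  have hum : Measurable u := hAm.add_const 1
  have hu1 : ∀ x, 1 ≤ u x := fun x => le_add_self
  have hus : ∫⁻ x, u x ^ s ∂μ ≠ ⊤ := by
    refine ne_top_of_le_ne_top (ENNReal.add_ne_top.2 ⟨hA, measure_ne_top μ univ⟩) ?_
    calc ∫⁻ x, u x ^ s ∂μ ≤ ∫⁻ x, (A x ^ s + 1) ∂μ := by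
          refine lintegral_mono fun x => ?_
          refine (ENNReal.rpow_add_le_add_rpow _ _ hs0.le hs.le).trans_eq ?_
          rw [ENNReal.one_rpow]
      _ = _ := by rw [lintegral_add_right _ measurable_const, lintegral_one]
  have hut : ∀ᵐ x ∂μ, u x ≠ ⊤ := by
    filter_upwards [ae_lt_top (hum.pow_const s) hus] with x hx h
    rw [h, ENNReal.top_rpow_of_pos hs0] at hx
    exact lt_irrefl _ hx
  set δ := s / 2 with hδ
  set κ := 2 * (1 - s) / s with hκ
  have hδ0 : 0 < δ := by positivity
  have hκ0 : 0 < κ := div_pos (by linarith) hs0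
  set M := mxf μ R (fun x => u x ^ δ) with hM
  have hMm : Measurable M := mxf_meas _ _ _
  have hM2 : ∫⁻ x, M x ^ (2:ℝ) ∂μ ≠ ⊤ := by
    refine ne_top_of_le_ne_top ?_ (mxf_strong μ R D hD 2 (by norm_num) _ (hum.pow_const δ))
    refine ENNReal.mul_ne_top (ENNReal.mul_ne_top (by simp) (ENNReal.mul_ne_top
      (ENNReal.mul_ne_top (by simp) hDtop)
      (ENNReal.mul_ne_top (ENNReal.rpow_ne_top_of_nonneg (by norm_num) (by simp)) (by simp)))) ?_
    have : ∀ x, (u x ^ δ) ^ (2:ℝ) = u x ^ s := by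
      intro x; rw [← ENNReal.rpow_mul]; congr 1; rw [hδ]; ring
    simp_rw [this]; exact hus
  have hM1 : ∀ x, M x ≠ 0 := by
    intro x
    have h1 : (1:ℝ≥0∞) ≤ (∫⁻ y in ball x R, u y ^ δ ∂μ) / μ (ball x R) := by
      rw [ENNReal.le_div_iff_mul_le (Or.inl (measure_ball_pos μ x (by linarith)).ne')
        (Or.inl (measure_ne_top _ _)), one_mul, ← setLIntegral_one]
      exact lintegral_mono fun y => ENNReal.one_le_rpow (hu1 y) hδ0
    have h2 := le_mxf μ R (fun x => u x ^ δ) (by linarith) le_rfl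
      (mem_ball_self (x := x) (show 0 < R by linarith))
    exact (lt_of_lt_of_le one_pos (h1.trans h2)).ne'
  have hMt : ∀ᵐ x ∂μ, M x ≠ ⊤ := by
    filter_upwards [ae_lt_top (hMm.pow_const 2) hM2] with x hx h
    rw [h, ENNReal.top_rpow_of_pos (by norm_num)] at hx
    exact lt_irrefl _ hx
  have hDD : D * D ^ κ ≠ ⊤ :=
    ENNReal.mul_ne_top hDtop (ENNReal.rpow_ne_top_of_nonneg hκ0.le hDtop)
  have hw : ∫⁻ x, A' x * M x ^ (-κ) ∂μ ≠ ⊤ := by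
    refine ne_top_of_le_ne_top (ENNReal.mul_ne_top hDD hus) ?_
    calc ∫⁻ x, A' x * M x ^ (-κ) ∂μ
        = ∫⁻ y, (∫⁻ x in ball (c y) (R * r y), M x ^ (-κ) ∂μ) ∂ν :=
          fub μ ν c _ hc (hr.const_mul R) _ (hMm.pow_const _)
      _ ≤ ∫⁻ y, D * D ^ κ * (∫⁻ x in ball (c y) (r y), u x ^ (-(δ * κ)) ∂μ) ∂ν := by
          refine lintegral_mono_ae ?_
          filter_upwards [hrp] with y hy
          exact wt_bound μ R hR D hDtop hD1 hDR u hum hu1 hut δ κ hδ0 hκ0 _ _ hy.1 hy.2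
      _ = D * D ^ κ * ∫⁻ x, A x * u x ^ (-(δ * κ)) ∂μ := by
          rw [lintegral_const_mul' _ _ hDD, fub μ ν c r hc hr _ (hum.pow_const _)]
      _ ≤ D * D ^ κ * ∫⁻ x, u x ^ s ∂μ := by
          gcongr 1
          refine lintegral_mono_ae ?_
          filter_upwards [hut] with x hx
          calc A x * u x ^ (-(δ * κ)) ≤ u x * u x ^ (-(δ * κ)) := by
                gcongr; exact le_self_add
            _ = u x ^ (1 + -(δ * κ)) := by
                rw [ENNReal.rpow_add _ _ (lt_of_lt_of_le one_pos (hu1 x)).ne' hx, ENNReal.rpow_one]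
            _ = u x ^ s := by
                congr 1; rw [hδ, hκ]; field_simp; ring
  have hconj : (1 / s).HolderConjugate (1 / (1 - s)) := by
    rw [Real.holderConjugate_iff]
    have : 0 < 1 - s := by linarith
    constructor
    · rw [lt_div_iff₀ hs0]; linarith
    · simp
  have h1s : 0 < 1 - s := by linarith
  refine ne_top_of_le_ne_top (ENNReal.mul_ne_top (ENNReal.rpow_ne_top_of_nonneg hs0.le hw)
    (ENNReal.rpow_ne_top_of_nonneg h1s.le hM2)) ?_
  calc ∫⁻ x, A' x ^ s ∂μ
      = ∫⁻ x, ((fun x => (A' x * M x ^ (-κ)) ^ s) * (fun x => M x ^ (κ * s))) x ∂μ := by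
        refine lintegral_congr_ae ?_
        filter_upwards [hMt] with x hx
        simp only [Pi.mul_apply]
        rw [ENNReal.mul_rpow_of_nonneg _ _ hs0.le, ← ENNReal.rpow_mul, mul_assoc,
          ← ENNReal.rpow_add _ _ (hM1 x) hx]
        simp
    _ ≤ _ := ENNReal.lintegral_mul_le_Lp_mul_Lq μ hconj
          ((hA'm.mul (hMm.pow_const _)).pow_const _).aemeasurable (hMm.pow_const _).aemeasurable
    _ = _ := by
        simp only [← ENNReal.rpow_mul, one_div_one_div]
        congr 3
        · funext x
          rw [mul_one_div_cancel hs0.ne', ENNReal.rpow_one]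
        · funext x
          congr 1; rw [hκ]; field_simp

lemma aper (μ : Measure X) [IsFiniteMeasure μ] [μ.IsOpenPosMeasure] (R : ℝ) (hR : 1 ≤ R)
    (hdoub : ∀ R : ℝ, 1 ≤ R → ∃ D : ℝ≥0∞, D ≠ ⊤ ∧
      ∀ (c : X) (r : ℝ), 0 < r → μ (ball c (R * r)) ≤ D * μ (ball c r))
    (ν : Measure Y) [SFinite ν] (c : Y → X) (r : Y → ℝ) (hc : Measurable c) (hr : Measurable r)
    (hrp : ∀ᵐ y ∂ν, 0 < r y ∧ r y ≤ 1) (s : ℝ) (hs0 : 0 < s)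
    (hA : ∫⁻ x, ν {y | x ∈ ball (c y) (r y)} ^ s ∂μ ≠ ⊤) :
    ∫⁻ x, ν {y | x ∈ ball (c y) (R * r y)} ^ s ∂μ ≠ ⊤ := by
  obtain ⟨D1, hD1, hD1'⟩ := hdoub 5 (by norm_num)
  obtain ⟨D2, hD2, hD2'⟩ := hdoub R hR
  have hDtop : D1 + D2 + 1 ≠ ⊤ := by simp [hD1, hD2]
  have h5 : ∀ (c : X) (r : ℝ), 0 < r → μ (ball c (5 * r)) ≤ (D1 + D2 + 1) * μ (ball c r) := by
    intro c r hr
    refine (hD1' c r hr).trans ?_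
    gcongr; rw [add_assoc]; exact le_self_add
  have h6 : ∀ (c : X) (r : ℝ), 0 < r → μ (ball c (R * r)) ≤ (D1 + D2 + 1) * μ (ball c r) := by
    intro c r hr
    refine (hD2' c r hr).trans ?_
    gcongr; exact le_self_add.trans' le_add_self
  rcases lt_trichotomy s 1 with h | h | h
  · exact aper_lt μ R hR _ hDtop le_add_self h5 h6 ν c r hc hr hrp s hs0 h hA
  · subst h
    simp only [ENNReal.rpow_one] at hA ⊢
    exact aper_one μ R _ hDtop h6 ν c r hc hr hrp hA
  · exact aper_gt μ R hR _ hDtop h5 h6 ν c r hc hr hrp s h hA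

end aperture

section circ

instance fact_two_pi : Fact (0 < 2 * Real.pi) := ⟨Real.two_pi_pos⟩

/-- exponential on the additive circle -/
noncomputable def ecirc (x : AddCircle (2 * Real.pi)) : ℂ := (AddCircle.toCircle x : ℂ)

lemma ecirc_coe (θ : ℝ) : ecirc (θ : AddCircle (2 * Real.pi)) = Complex.exp (θ * Complex.I) := by
  unfold ecirc
  rw [AddCircle.toCircle_apply_mk, Circle.coe_exp]
  congr 2
  rw [div_self Real.two_pi_pos.ne', one_mul]

lemma ecirc_cont : Continuous ecirc :=
  continuous_subtype_val.comp AddCircle.continuous_toCircle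

lemma ecirc_sub (x y : AddCircle (2 * Real.pi)) : ‖ecirc x - ecirc y‖ = ‖ecirc (x - y) - 1‖ := by
  induction x using QuotientAddGroup.induction_on with | H a =>
  induction y using QuotientAddGroup.induction_on with | H b =>
  have : ((a : AddCircle (2 * Real.pi)) - (b : AddCircle (2 * Real.pi))) = ((a - b : ℝ) : AddCircle (2 * Real.pi)) := by
    simp
  rw [this, ecirc_coe, ecirc_coe, ecirc_coe]
  have h : Complex.exp (a * Complex.I) - Complex.exp (b * Complex.I) =
      Complex.exp (b * Complex.I) * (Complex.exp ((a - b : ℝ) * Complex.I) - 1) := by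
    rw [mul_sub, ← Complex.exp_add, mul_one]; congr 2; push_cast; ring
  rw [h, norm_mul, Complex.norm_exp_ofReal_mul_I, one_mul]

lemma exists_rep (t : AddCircle (2 * Real.pi)) : ∃ θ : ℝ, (θ : AddCircle (2 * Real.pi)) = t ∧
    ‖t‖ = |θ| ∧ |θ| ≤ Real.pi := by
  induction t using QuotientAddGroup.induction_on with | H a =>
  refine ⟨a - round ((2 * Real.pi)⁻¹ * a) * (2 * Real.pi), ?_, AddCircle.norm_eq _, ?_⟩
  · rw [AddCircle.coe_sub, ← zsmul_eq_mul, AddCircle.coe_zsmul, AddCircle.coe_period]; simp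
  · rw [← AddCircle.norm_eq]
    have := AddCircle.norm_le_half_period (p := 2 * Real.pi) (x := (a : AddCircle (2 * Real.pi))) Real.two_pi_pos.ne'
    rwa [abs_of_pos Real.two_pi_pos, mul_div_cancel_left₀ _ (by norm_num)] at this

lemma chord_le (x y : AddCircle (2 * Real.pi)) : ‖ecirc x - ecirc y‖ ≤ dist x y := by
  rw [ecirc_sub, dist_eq_norm]
  obtain ⟨θ, h1, h2, h3⟩ := exists_rep (x - y)
  rw [h2, ← h1, ecirc_coe, mul_comm, Complex.norm_exp_I_mul_ofReal_sub_one, Real.norm_eq_abs,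
    abs_mul, abs_two]
  have := Real.abs_sin_le_abs (x := θ / 2)
  rw [abs_div, abs_two] at this
  linarith

lemma dist_le_chord (x y : AddCircle (2 * Real.pi)) : dist x y ≤ 2 * ‖ecirc x - ecirc y‖ := by
  rw [ecirc_sub, dist_eq_norm]
  obtain ⟨θ, h1, h2, h3⟩ := exists_rep (x - y)
  rw [h2, ← h1, ecirc_coe, mul_comm (θ : ℂ), Complex.norm_exp_I_mul_ofReal_sub_one, Real.norm_eq_abs,
    abs_mul, abs_two]
  have h4 : |θ / 2| ≤ Real.pi / 2 := by rw [abs_div, abs_two]; linarith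
  have := Real.mul_abs_le_abs_sin h4
  rw [abs_div, abs_two] at this
  have h5 : 2 / Real.pi * (|θ| / 2) = |θ| / Real.pi := by field_simp
  rw [h5, div_le_iff₀ Real.pi_pos] at this
  nlinarith [Real.pi_le_four, abs_nonneg (Real.sin (θ / 2))]

lemma circ_doub (R : ℝ) (hR : 1 ≤ R) : ∃ D : ℝ≥0∞, D ≠ ⊤ ∧
      ∀ (c : AddCircle (2 * Real.pi)) (r : ℝ), 0 < r →
        volume (ball c (R * r)) ≤ D * volume (ball c r) := by
  refine ⟨ENNReal.ofReal (2 * R), ENNReal.ofReal_ne_top, fun c r hr => ?_⟩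
  calc volume (ball c (R * r)) ≤ volume (closedBall c (R * r)) := measure_mono ball_subset_closedBall
    _ = ENNReal.ofReal (min (2 * Real.pi) (2 * (R * r))) := AddCircle.volume_closedBall _ _
    _ ≤ ENNReal.ofReal (2 * R * min (2 * Real.pi) (2 * (r / 2))) := by
        apply ENNReal.ofReal_le_ofReal
        rw [mul_min_of_nonneg _ _ (by linarith)]
        refine min_le_min ?_ (by linarith)
        nlinarith [Real.pi_pos]
    _ = ENNReal.ofReal (2 * R) * volume (closedBall c (r / 2)) := by
        rw [AddCircle.volume_closedBall, ENNReal.ofReal_mul (by linarith)]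
    _ ≤ _ := by
        gcongr
        exact closedBall_subset_ball (by linarith)

lemma tentG_eq (p q ζ : ℝ) (G : Set ℂ) (F : ℂ → ℝ) : tentG p q ζ G F =
    ∫⁻ x : AddCircle (2 * Real.pi),
      (∫⁻ z in ntReg ζ (ecirc x) ∩ G, ENNReal.ofReal (F z)) ^ (q / p) := by
  rw [← AddCircle.lintegral_preimage (2 * Real.pi) 0, zero_add]
  unfold tentG
  simp_rw [ecirc_coe]

/-- angular centre -/
noncomputable def cen (z : ℂ) : AddCircle (2 * Real.pi) := ((Complex.arg z : ℝ) : AddCircle (2 * Real.pi))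

lemma cen_meas : Measurable cen :=
  AddCircle.measurable_mk'.comp Complex.measurable_arg

lemma cen_dist (z : ℂ) (hz : ‖z‖ ≤ 1) : ‖z - ecirc (cen z)‖ = 1 - ‖z‖ := by
  unfold cen
  rw [ecirc_coe]
  have h : z - Complex.exp (Complex.arg z * Complex.I) =
      ((‖z‖ - 1 : ℝ) : ℂ) * Complex.exp (Complex.arg z * Complex.I) := by
    conv_lhs => enter [1]; rw [← Complex.norm_mul_exp_arg_mul_I z]
    push_cast; ring
  rw [h, norm_mul, Complex.norm_exp_ofReal_mul_I, mul_one, Complex.norm_real, Real.norm_eq_abs,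
    abs_of_nonpos (by linarith)]
  ring

lemma nt_joint (ζ : ℝ) (S : Set ℂ) (hS : MeasurableSet S) :
    MeasurableSet {a : AddCircle (2 * Real.pi) × ℂ | a.2 ∈ ntReg ζ (ecirc a.1) ∩ S} := by
  have he := ecirc_cont.measurable
  have h1 : MeasurableSet {a : AddCircle (2 * Real.pi) × ℂ | ‖a.2‖ < 1} :=
    measurableSet_lt (by fun_prop) (by fun_prop)
  have h2 : MeasurableSet {a : AddCircle (2 * Real.pi) × ℂ |
      ‖a.2 - ecirc a.1‖ < ζ * (1 - ‖a.2‖ ^ 2)} :=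
    measurableSet_lt (by fun_prop) (by fun_prop)
  have h3 : MeasurableSet {a : AddCircle (2 * Real.pi) × ℂ | a.2 ∈ S} := measurable_snd hS
  convert (h1.inter h2).inter h3 using 1
  ext a
  simp [ntReg]

lemma nt_meas (ζ : ℝ) (η : ℂ) : MeasurableSet (ntReg ζ η) := by
  have h1 : MeasurableSet {a : ℂ | ‖a‖ < 1} :=
    measurableSet_lt (by fun_prop) (by fun_prop)
  have h2 : MeasurableSet {a : ℂ | ‖a - η‖ < ζ * (1 - ‖a‖ ^ 2)} :=
    measurableSet_lt (by fun_prop) (by fun_prop)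
  convert h1.inter h2 using 1
  ext a
  simp [ntReg]

lemma ind_meas {E : Type*} [TopologicalSpace E] [MeasurableSpace E] [BorelSpace E] (U : Set ℂ)
    (hU : IsOpen U) (F : ℂ → E) (hF : ContinuousOn F U) (L : E → ℝ≥0∞) (hL : Measurable L) :
    Measurable (U.indicator (fun z => L (F z))) := by
  refine measurable_of_restrict_of_restrict_compl (s := U) hU.measurableSet ?_ ?_
  · have : U.domRestrict (U.indicator (fun z => L (F z))) = fun z => L (U.domRestrict F z) := by
      funext z; simp only [Set.domRestrict_apply]; rw [Set.indicator_of_mem z.2]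
    rw [this]
    exact hL.comp (continuousOn_iff_continuous_domRestrict.1 hF).measurable
  · have : (Uᶜ).domRestrict (U.indicator (fun z => L (F z))) = fun z => 0 := by
      funext z; simp only [Set.domRestrict_apply]; rw [Set.indicator_of_notMem z.2]
    rw [this]; exact measurable_const

lemma inner_meas (ζ : ℝ) (S : Set ℂ) (hS : MeasurableSet S) (F : ℂ → ℝ)
    (hF : ContinuousOn F (ball 0 1)) :
    Measurable fun x : AddCircle (2 * Real.pi) =>
      ∫⁻ z in ntReg ζ (ecirc x) ∩ S, ENNReal.ofReal (F z) := by
  set K : ℂ → ℝ≥0∞ := (ball (0:ℂ) 1).indicator (fun z => ENNReal.ofReal (F z)) with hK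
  have hKm : Measurable K := ind_meas _ isOpen_ball F hF _ ENNReal.measurable_ofReal
  set T := {a : AddCircle (2 * Real.pi) × ℂ | a.2 ∈ ntReg ζ (ecirc a.1) ∩ S} with hT
  have hTm : MeasurableSet T := nt_joint ζ S hS
  have : ∀ x, ∫⁻ z in ntReg ζ (ecirc x) ∩ S, ENNReal.ofReal (F z) =
      ∫⁻ z, T.indicator (fun a => K a.2) (x, z) := by
    intro x
    rw [← lintegral_indicator ((nt_meas _ _).inter hS)]
    refine lintegral_congr fun z => ?_
    by_cases hz : z ∈ ntReg ζ (ecirc x) ∩ S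
    · rw [Set.indicator_of_mem hz, Set.indicator_of_mem (show (x, z) ∈ T from hz)]
      simp only [hK]
      rw [Set.indicator_of_mem hz.1.1]
    · rw [Set.indicator_of_notMem hz, Set.indicator_of_notMem (show (x, z) ∉ T from hz)]
  simp_rw [this]
  exact ((hKm.comp measurable_snd).indicator hTm).lintegral_prod_right'

end circ

section analytic

lemma circ_mean (f : ℂ → ℂ) (w : ℂ) (r ρ : ℝ) (hf : DifferentiableOn ℂ f (ball w r))
    (hρ : 0 < ρ) (hρr : ρ < r) :
    ENNReal.ofReal (2 * Real.pi) * ‖f w‖ₑ ≤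
      ∫⁻ θ in Ioo (-Real.pi) Real.pi, ‖f (circleMap w ρ θ)‖ₑ := by
  have hd : DiffContOnCl ℂ f (ball w |ρ|) := by
    apply DifferentiableOn.diffContOnCl
    rw [abs_of_pos hρ]
    exact hf.mono (closure_ball_subset_closedBall.trans (closedBall_subset_ball hρr))
  have h1 := hd.circleAverage
  rw [Real.circleAverage_def] at h1
  have hper : Function.Periodic (fun θ => f (circleMap w ρ θ)) (2 * Real.pi) := by
    intro θ; simp only [periodic_circleMap w ρ θ]
  have h2 := hper.intervalIntegral_add_eq 0 (-Real.pi)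
  rw [zero_add, show -Real.pi + 2 * Real.pi = Real.pi by ring] at h2
  rw [h2] at h1
  have h3 : ∫ θ in (-Real.pi)..Real.pi, f (circleMap w ρ θ) = (2 * Real.pi) • f w := by
    rw [← h1, smul_inv_smul₀ Real.two_pi_pos.ne']
  have h4 : ENNReal.ofReal (2 * Real.pi) * ‖f w‖ₑ = ‖(2 * Real.pi) • f w‖ₑ := by
    rw [enorm_smul, Real.enorm_eq_ofReal Real.two_pi_pos.le]
  rw [h4, ← h3, intervalIntegral.integral_of_le (by linarith [Real.pi_pos]),
    integral_Ioc_eq_integral_Ioo]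
  exact enorm_integral_le_lintegral_enorm _

lemma area_mean (f : ℂ → ℂ) (w : ℂ) (r : ℝ) (hf : DifferentiableOn ℂ f (ball w r))
    (hr : 0 < r) :
    ENNReal.ofReal (Real.pi * r ^ 2) * ‖f w‖ₑ ≤ ∫⁻ z in ball w r, ‖f z‖ₑ := by
  set h : ℂ → ℝ≥0∞ := (ball w r).indicator (fun z => ‖f z‖ₑ) with hh
  have hm : Measurable h := ind_meas _ isOpen_ball f hf.continuousOn _ measurable_enorm
  have e1 : ∫⁻ z in ball w r, ‖f z‖ₑ = ∫⁻ z, h (w + z) := by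
    rw [lintegral_add_left_eq_self h w, lintegral_indicator measurableSet_ball]
  have hcm : ∀ p : ℝ × ℝ, w + Complex.polarCoord.symm p = circleMap w p.1 p.2 := by
    intro p
    rw [Complex.polarCoord_symm_apply, circleMap, Complex.exp_mul_I]
    push_cast; rfl
  rw [e1, ← Complex.lintegral_comp_polarCoord_symm]
  have ht : polarCoord.target = Ioi (0:ℝ) ×ˢ Ioo (-Real.pi) Real.pi := rfl
  simp_rw [hcm, smul_eq_mul]
  rw [ht, Measure.volume_eq_prod, setLIntegral_prod]
  swap
  · refine Measurable.aemeasurable ?_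
    refine Measurable.mul (by fun_prop) (hm.comp ?_)
    unfold circleMap
    fun_prop
  calc ENNReal.ofReal (Real.pi * r ^ 2) * ‖f w‖ₑ
      = ENNReal.ofReal (2 * Real.pi) * ‖f w‖ₑ * (ENNReal.ofReal (1 / 2) * ENNReal.ofReal r ^ (2:ℝ)) := by
        rw [ENNReal.ofReal_rpow_of_nonneg hr.le (by norm_num)]
        rw [mul_right_comm, ← ENNReal.ofReal_mul (by norm_num),
          ← ENNReal.ofReal_mul (by positivity)]
        congr 2
        rw [Real.rpow_two]; ring
    _ = ENNReal.ofReal (2 * Real.pi) * ‖f w‖ₑ * ∫⁻ l in Ioi (0:ℝ), ENNReal.ofReal (l ^ ((2:ℝ) - 1)) *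
          (if ENNReal.ofReal l < ENNReal.ofReal r then 1 else 0) := by
        rw [layer 2 (by norm_num)]
    _ = ∫⁻ l in Ioi (0:ℝ), ENNReal.ofReal (2 * Real.pi) * ‖f w‖ₑ * (ENNReal.ofReal (l ^ ((2:ℝ) - 1)) *
          (if ENNReal.ofReal l < ENNReal.ofReal r then 1 else 0)) := by
        rw [lintegral_const_mul' _ _ (ENNReal.mul_ne_top ENNReal.ofReal_ne_top enorm_ne_top)]
    _ ≤ _ := by
        refine setLIntegral_mono' measurableSet_Ioi fun l hl => ?_
        have hl' : (0:ℝ) < l := hl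
        dsimp only
        rw [lintegral_const_mul' _ _ ENNReal.ofReal_ne_top, show (2:ℝ) - 1 = 1 by norm_num, Real.rpow_one]
        by_cases hlr : l < r
        · rw [if_pos ((ENNReal.ofReal_lt_ofReal_iff hr).2 hlr), mul_one, mul_comm]
          gcongr
          refine (circ_mean f w r l hf hl' hlr).trans (lintegral_mono fun θ => ?_)
          rw [hh]
          rw [Set.indicator_of_mem]
          rw [mem_ball_iff_norm]
          simp [abs_of_pos hl', hlr]
        · rw [if_neg (fun h => hlr ((ENNReal.ofReal_lt_ofReal_iff hr).1 h))]
          simp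

lemma area_mean_p (f : ℂ → ℂ) (w : ℂ) (r p : ℝ) (hp : 1 ≤ p) (hf : DifferentiableOn ℂ f (ball w r))
    (hr : 0 < r) :
    ENNReal.ofReal (Real.pi * r ^ 2) * ‖f w‖ₑ ^ p ≤ ∫⁻ z in ball w r, ‖f z‖ₑ ^ p := by
  have h1 := area_mean f w r hf hr
  rcases hp.eq_or_lt with rfl | hp
  · simpa using h1
  have hp0 : 0 < p := by linarith
  have hconj : p.HolderConjugate (p / (p - 1)) := Real.HolderConjugate.conjExponent hp
  have hV : volume (ball w r) = ENNReal.ofReal (Real.pi * r ^ 2) := by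
    rw [Complex.volume_ball, ← ENNReal.ofReal_pow hr.le, mul_comm, ENNReal.ofReal_mul Real.pi_pos.le]
    congr 1
    rw [← NNReal.coe_real_pi, ENNReal.ofReal_coe_nnreal]
  set V := ENNReal.ofReal (Real.pi * r ^ 2) with hVd
  have hV0 : V ≠ 0 := by rw [hVd]; simp; positivity
  have hVt : V ≠ ⊤ := by rw [hVd]; simp
  have hfm : AEMeasurable (fun z => ‖f z‖ₑ) (volume.restrict (ball w r)) :=
    (hf.continuousOn.aestronglyMeasurable measurableSet_ball).enorm
  have h2 : ∫⁻ z in ball w r, ‖f z‖ₑ ≤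
      (∫⁻ z in ball w r, ‖f z‖ₑ ^ p) ^ (1 / p) * V ^ (1 / (p / (p - 1))) := by
    have := ENNReal.lintegral_mul_le_Lp_mul_Lq (volume.restrict (ball w r)) hconj hfm
      (g := fun _ => 1) aemeasurable_const
    simpa [hV] using this
  have h3 := ENNReal.rpow_le_rpow (h1.trans h2) hp0.le
  rw [ENNReal.mul_rpow_of_nonneg _ _ hp0.le, ENNReal.mul_rpow_of_nonneg _ _ hp0.le,
    ← ENNReal.rpow_mul, ← ENNReal.rpow_mul, one_div_mul_cancel hp0.ne', ENNReal.rpow_one,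
    show 1 / (p / (p - 1)) * p = p - 1 by field_simp] at h3
  have h4 : V ^ p = V ^ (p - 1) * V := by
    rw [show p = (p - 1) + 1 by ring, ENNReal.rpow_add _ _ hV0 hVt, ENNReal.rpow_one]; simp
  rw [h4, mul_assoc, mul_comm _ (V ^ (p - 1))] at h3
  refine (ENNReal.mul_le_mul_iff_right ?_ ?_).1 h3
  · simp [ENNReal.rpow_eq_zero_iff, hV0, hVt]
  · exact ENNReal.rpow_ne_top_of_nonneg (by linarith) hVt

/-- derivative bound by area means -/
lemma deriv_mean (f : ℂ → ℂ) (z : ℂ) (r p : ℝ) (k : ℕ) (hp : 1 ≤ p)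
    (hf : DifferentiableOn ℂ f (ball z r)) (hr : 0 < r) :
    ENNReal.ofReal (r ^ 2) * ENNReal.ofReal ((‖iteratedDeriv k f z‖ * r ^ k) ^ p) ≤
      ENNReal.ofReal (((k.factorial : ℝ) * 2 ^ k) ^ p * 4) * ∫⁻ w in ball z r, ‖f w‖ₑ ^ p := by
  have hp0 : 0 < p := by linarith
  have hr2 : 0 < r / 2 := by linarith
  have hne : (sphere z (r / 2)).Nonempty := NormedSpace.sphere_nonempty.2 hr2.le
  have hsub : closedBall z (r / 2) ⊆ ball z r := closedBall_subset_ball (by linarith)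
  obtain ⟨w0, hw0, hmax⟩ := (isCompact_sphere z (r / 2)).exists_isMaxOn hne
    ((hf.continuousOn.mono (sphere_subset_closedBall.trans hsub)).norm)
  have hd : DiffContOnCl ℂ f (ball z (r / 2)) :=
    DifferentiableOn.diffContOnCl (hf.mono (closure_ball_subset_closedBall.trans hsub))
  have hcau := Complex.norm_iteratedDeriv_le_of_forall_mem_sphere_norm_le k hr2 hd
    (fun w hw => hmax hw)
  have hb : ‖iteratedDeriv k f z‖ * r ^ k ≤ (k.factorial : ℝ) * 2 ^ k * ‖f w0‖ := by
    rw [le_div_iff₀ (by positivity), div_pow] at hcau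
    calc ‖iteratedDeriv k f z‖ * r ^ k = ‖iteratedDeriv k f z‖ * (r ^ k / 2 ^ k) * 2 ^ k := by
          field_simp
      _ ≤ k.factorial * ‖f w0‖ * 2 ^ k := by gcongr
      _ = _ := by ring
  have hb2 : (‖iteratedDeriv k f z‖ * r ^ k) ^ p ≤ ((k.factorial : ℝ) * 2 ^ k) ^ p * ‖f w0‖ ^ p := by
    rw [← Real.mul_rpow (by positivity) (by positivity)]
    exact Real.rpow_le_rpow (by positivity) hb hp0.le
  have hsub2 : ball w0 (r / 2) ⊆ ball z r := by
    apply ball_subset_ball'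
    rw [mem_sphere.1 hw0]; linarith
  have h1 := area_mean_p f w0 (r / 2) p hp (hf.mono hsub2) hr2
  have he : ENNReal.ofReal (‖f w0‖ ^ p) = ‖f w0‖ₑ ^ p := by
    rw [← ENNReal.ofReal_rpow_of_nonneg (norm_nonneg _) hp0.le, ofReal_norm]
  calc _ ≤ ENNReal.ofReal (4 * (Real.pi * (r / 2) ^ 2)) *
        ENNReal.ofReal (((k.factorial : ℝ) * 2 ^ k) ^ p * ‖f w0‖ ^ p) := by
        gcongr
        nlinarith [Real.pi_gt_three, sq_nonneg r]
    _ = ENNReal.ofReal (((k.factorial : ℝ) * 2 ^ k) ^ p * 4) *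
        (ENNReal.ofReal (Real.pi * (r / 2) ^ 2) * ‖f w0‖ₑ ^ p) := by
        rw [← he, ← ENNReal.ofReal_mul (by positivity), ← ENNReal.ofReal_mul (by positivity),
          ← ENNReal.ofReal_mul (by positivity)]
        congr 1; ring
    _ ≤ _ := by
        gcongr
        exact h1.trans (lintegral_mono_set hsub2)

end analytic

section finiteness

lemma rpow_add_le (a b : ℝ≥0∞) (s : ℝ) (hs : 0 < s) :
    (a + b) ^ s ≤ 2 ^ s * (a ^ s + b ^ s) := by
  rw [mul_add, ← ENNReal.mul_rpow_of_nonneg _ _ hs.le, ← ENNReal.mul_rpow_of_nonneg _ _ hs.le]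
  rcases le_total a b with h | h
  · refine (ENNReal.rpow_le_rpow (?_ : a + b ≤ 2 * b) hs.le).trans le_add_self
    rw [two_mul]; gcongr
  · refine (ENNReal.rpow_le_rpow (?_ : a + b ≤ 2 * a) hs.le).trans le_self_add
    rw [two_mul]; gcongr

lemma rpow_comp (a b α : ℝ) (ha : 0 < a) (hb : 0 < b) (hab : a ≤ 4 * b) (hba : b ≤ 4 * a) :
    a ^ α ≤ 4 ^ |α| * b ^ α := by
  rcases le_total 0 α with h | h
  · rw [abs_of_nonneg h, ← Real.mul_rpow (by norm_num) hb.le]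
    exact Real.rpow_le_rpow ha.le hab h
  · rw [abs_of_nonpos h, Real.rpow_neg (by norm_num), ← Real.inv_rpow (by norm_num),
      ← Real.mul_rpow (by norm_num) hb.le]
    exact Real.rpow_le_rpow_of_nonpos (by positivity) (by linarith) h

lemma ptwise (p α : ℝ) (hp : 1 ≤ p) (k : ℕ) : ∃ K : ℝ≥0∞, K ≠ ⊤ ∧ ∀ f : ℂ → ℂ,
    DifferentiableOn ℂ f (ball 0 1) → ∀ z ∈ ball (0:ℂ) 1,
    ENNReal.ofReal (‖iteratedDeriv k f z‖ ^ p * (1 - ‖z‖^2) ^ ((k:ℝ)*p + α)) ≤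
      K * ∫⁻ w in ball z ((1 - ‖z‖) / 2), ENNReal.ofReal (((1 - ‖w‖) ^ 2)⁻¹) *
        ENNReal.ofReal (‖f w‖ ^ p * (1 - ‖w‖^2) ^ α) := by
  refine ⟨ENNReal.ofReal ((4 ^ k) ^ p) * ENNReal.ofReal (((k.factorial : ℝ) * 2 ^ k) ^ p * 4) *
    ENNReal.ofReal (9 * 4 ^ |α|), by finiteness, fun f hf z hz => ?_⟩
  have hp0 : 0 < p := by linarith
  have hz1 : ‖z‖ < 1 := by simpa using hz
  have hz0 := norm_nonneg z
  set ρ := (1 - ‖z‖) / 2 with hρ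
  have hρ0 : 0 < ρ := by linarith
  have hball : ∀ w ∈ ball z ρ, 1 - ‖w‖ ≤ 3 * ρ ∧ ρ ≤ 1 - ‖w‖ := by
    intro w hw
    rw [mem_ball_iff_norm] at hw
    have h1 := norm_sub_norm_le w z
    have h2 := norm_sub_norm_le z w
    rw [norm_sub_rev] at h2
    constructor <;> linarith
  have hsub : ball z ρ ⊆ ball 0 1 := by
    intro w hw
    have := hball w hw
    rw [mem_ball_zero_iff]; linarith
  have hdm := deriv_mean f z ρ p k hp (hf.mono hsub) hρ0
  set D := ‖iteratedDeriv k f z‖ with hD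
  have hD0 : 0 ≤ D := norm_nonneg _
  set I := ∫⁻ w in ball z ρ, ‖f w‖ₑ ^ p with hI
  set K1 := ENNReal.ofReal (((k.factorial : ℝ) * 2 ^ k) ^ p * 4) with hK1
  have ha0 : 0 < 1 - ‖z‖ ^ 2 := by nlinarith
  have hstep1 : D ^ p * (1 - ‖z‖^2) ^ ((k:ℝ)*p + α) ≤
      (4 ^ k) ^ p * ((ρ ^ 2)⁻¹ * (1 - ‖z‖ ^ 2) ^ α) * (ρ ^ 2 * (D * ρ ^ k) ^ p) := by
    rw [Real.rpow_add ha0, Real.rpow_mul ha0.le, Real.rpow_natCast, ← mul_assoc,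
      ← Real.mul_rpow hD0 (by positivity)]
    have : (D * (1 - ‖z‖ ^ 2) ^ k) ^ p ≤ (4 ^ k) ^ p * (D * ρ ^ k) ^ p := by
      rw [← Real.mul_rpow (by positivity) (by positivity)]
      refine Real.rpow_le_rpow (by positivity) ?_ hp0.le
      rw [mul_left_comm, ← mul_pow]
      gcongr
      nlinarith
    calc _ ≤ (4 ^ k) ^ p * (D * ρ ^ k) ^ p * (1 - ‖z‖ ^ 2) ^ α := by gcongr
      _ = _ := by field_simp
  calc _ ≤ ENNReal.ofReal ((4 ^ k) ^ p * ((ρ ^ 2)⁻¹ * (1 - ‖z‖ ^ 2) ^ α) * (ρ ^ 2 * (D * ρ ^ k) ^ p)) :=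
        ENNReal.ofReal_le_ofReal hstep1
    _ = ENNReal.ofReal ((4 ^ k) ^ p) * ENNReal.ofReal ((ρ ^ 2)⁻¹ * (1 - ‖z‖ ^ 2) ^ α) *
        (ENNReal.ofReal (ρ ^ 2) * ENNReal.ofReal ((D * ρ ^ k) ^ p)) := by
        rw [ENNReal.ofReal_mul (by positivity), ENNReal.ofReal_mul (p := (4 ^ k) ^ p) (by positivity),
          ENNReal.ofReal_mul (p := ρ ^ 2) (by positivity)]
    _ ≤ ENNReal.ofReal ((4 ^ k) ^ p) * ENNReal.ofReal ((ρ ^ 2)⁻¹ * (1 - ‖z‖ ^ 2) ^ α) * (K1 * I) := by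
        gcongr
    _ = ENNReal.ofReal ((4 ^ k) ^ p) * K1 * (ENNReal.ofReal ((ρ ^ 2)⁻¹ * (1 - ‖z‖ ^ 2) ^ α) * I) := by
        ring
    _ ≤ ENNReal.ofReal ((4 ^ k) ^ p) * K1 * (ENNReal.ofReal (9 * 4 ^ |α|) *
        ∫⁻ w in ball z ρ, ENNReal.ofReal (((1 - ‖w‖) ^ 2)⁻¹) *
        ENNReal.ofReal (‖f w‖ ^ p * (1 - ‖w‖^2) ^ α)) := by
        refine mul_le_mul' le_rfl ?_
        rw [hI, ← lintegral_const_mul' _ _ ENNReal.ofReal_ne_top,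
          ← lintegral_const_mul' _ _ ENNReal.ofReal_ne_top]
        refine setLIntegral_mono' measurableSet_ball fun w hw => ?_
        obtain ⟨h1, h2⟩ := hball w hw
        have hw0 := norm_nonneg w
        have he : ‖f w‖ₑ ^ p = ENNReal.ofReal (‖f w‖ ^ p) := by
          rw [← ENNReal.ofReal_rpow_of_nonneg (norm_nonneg _) hp0.le, ofReal_norm]
        have hb0 : 0 < 1 - ‖w‖ ^ 2 := by nlinarith
        have hw1 : 0 < 1 - ‖w‖ := by linarith
        rw [he, ← ENNReal.ofReal_mul (by positivity), ← ENNReal.ofReal_mul (by positivity),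
          ← ENNReal.ofReal_mul (by positivity)]
        apply ENNReal.ofReal_le_ofReal
        have hc := rpow_comp (1 - ‖z‖ ^ 2) (1 - ‖w‖ ^ 2) α ha0 hb0 (by nlinarith) (by nlinarith)
        have hi : (ρ ^ 2)⁻¹ ≤ 9 * ((1 - ‖w‖) ^ 2)⁻¹ := by
          rw [← div_eq_mul_inv, le_div_iff₀ (by positivity), inv_mul_le_iff₀ (by positivity)]
          nlinarith
        calc (ρ ^ 2)⁻¹ * (1 - ‖z‖ ^ 2) ^ α * ‖f w‖ ^ p ≤
            (9 * ((1 - ‖w‖) ^ 2)⁻¹) * (4 ^ |α| * (1 - ‖w‖ ^ 2) ^ α) * ‖f w‖ ^ p := by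
              gcongr
          _ = _ := by ring
    _ = _ := by ring

lemma tonelli (W : Set ℂ) (hW : MeasurableSet W) (hW1 : W ⊆ ball 0 1) (H : ℂ → ℝ≥0∞)
    (hH : Measurable H) :
    ∫⁻ z, ∫⁻ w, (W.indicator (fun w => ENNReal.ofReal (((1 - ‖w‖) ^ 2)⁻¹) * H w) w) *
      (if ‖w - z‖ < 1 - ‖w‖ then 1 else 0) ≤ ENNReal.ofReal Real.pi * ∫⁻ w in W, H w := by
  rw [lintegral_lintegral_swap]
  swap
  · refine Measurable.aemeasurable (Measurable.mul ?_ ?_)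
    · refine Measurable.comp (g := W.indicator (fun w => ENNReal.ofReal (((1 - ‖w‖) ^ 2)⁻¹) * H w))
        (Measurable.indicator (by fun_prop) hW) measurable_snd
    · refine Measurable.ite (measurableSet_lt (by fun_prop) (by fun_prop)) measurable_const
        measurable_const
  rw [← lintegral_indicator hW, ← lintegral_const_mul' _ _ ENNReal.ofReal_ne_top]
  refine lintegral_mono fun w => ?_
  by_cases hw : w ∈ W
  · have hw1 : 0 < 1 - ‖w‖ := by have := hW1 hw; rw [mem_ball_zero_iff] at this; linarith
    simp only [Set.indicator_of_mem hw]
    rw [lintegral_const_mul _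
      (Measurable.ite (measurableSet_lt (by fun_prop) (by fun_prop)) measurable_const
        measurable_const)]
    have e : ∫⁻ z, (if ‖w - z‖ < 1 - ‖w‖ then (1:ℝ≥0∞) else 0) = volume (ball w (1 - ‖w‖)) := by
      rw [← lintegral_indicator_one measurableSet_ball]
      refine lintegral_congr fun z => ?_
      by_cases hz : ‖w - z‖ < 1 - ‖w‖
      · rw [if_pos hz, Set.indicator_of_mem (by rwa [mem_ball_iff_norm']), Pi.one_apply]
      · rw [if_neg hz, Set.indicator_of_notMem (by rwa [mem_ball_iff_norm'])]
    rw [e, Complex.volume_ball, ← ENNReal.ofReal_pow hw1.le, mul_right_comm, ← mul_assoc,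
      ← ENNReal.ofReal_mul (by positivity), inv_mul_cancel₀ (by positivity), ENNReal.ofReal_one,
      one_mul, ← NNReal.coe_real_pi, ENNReal.ofReal_coe_nnreal]
  · simp [Set.indicator_of_notMem hw]

lemma cone_bound (p α : ℝ) (hp : 1 ≤ p) (k : ℕ) : ∃ K : ℝ≥0∞, K ≠ ⊤ ∧ ∀ f : ℂ → ℂ,
    DifferentiableOn ℂ f (ball 0 1) → ∀ H : ℂ → ℝ≥0∞, Measurable H →
    (∀ w ∈ ball (0:ℂ) 1, H w = ENNReal.ofReal (‖f w‖ ^ p * (1 - ‖w‖^2) ^ α)) →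
    ∀ Z W : Set ℂ, MeasurableSet Z →
    MeasurableSet W → Z ⊆ ball 0 1 → W ⊆ ball 0 1 →
    (∀ z ∈ Z, ∀ w, ‖w - z‖ < (1 - ‖z‖) / 2 → w ∈ W) →
    ∫⁻ z in Z, ENNReal.ofReal (‖iteratedDeriv k f z‖ ^ p * (1 - ‖z‖^2) ^ ((k:ℝ)*p + α)) ≤
      K * ∫⁻ w in W, H w := by
  obtain ⟨K, hK, h⟩ := ptwise p α hp k
  refine ⟨K * ENNReal.ofReal Real.pi, by finiteness, ?_⟩
  intro f hf H hHm hH Z W hZm hWm hZ hW hZW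
  calc _ ≤ ∫⁻ z in Z, K * ∫⁻ w, (W.indicator (fun w => ENNReal.ofReal (((1 - ‖w‖) ^ 2)⁻¹) * H w) w) *
      (if ‖w - z‖ < 1 - ‖w‖ then 1 else 0) := by
        refine setLIntegral_mono' hZm fun z hz => (h f hf z (hZ hz)).trans ?_
        refine mul_le_mul' le_rfl ?_
        rw [← lintegral_indicator measurableSet_ball]
        refine lintegral_mono fun w => ?_
        by_cases hw : w ∈ ball z ((1 - ‖z‖) / 2)
        · rw [Set.indicator_of_mem hw]
          rw [mem_ball_iff_norm] at hw
          have hwW := hZW z hz w hw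
          have h1 := norm_sub_norm_le w z
          rw [Set.indicator_of_mem hwW, if_pos (by linarith), mul_one, hH w (hW hwW)]
        · rw [Set.indicator_of_notMem hw]; exact zero_le
    _ ≤ ∫⁻ z, K * ∫⁻ w, (W.indicator (fun w => ENNReal.ofReal (((1 - ‖w‖) ^ 2)⁻¹) * H w) w) *
      (if ‖w - z‖ < 1 - ‖w‖ then 1 else 0) := setLIntegral_le_lintegral _ _
    _ ≤ _ := by
        rw [lintegral_const_mul' _ _ hK, mul_assoc]
        gcongr
        exact tonelli W hWm hW H hHm

end finiteness

section finiteness2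

lemma iter_cont (f : ℂ → ℂ) (hf : DifferentiableOn ℂ f (ball 0 1)) (k : ℕ) :
    ContinuousOn (iteratedDeriv k f) (ball 0 1) := by
  rw [iteratedDeriv_eq_iterate]
  exact (AnalyticOnNhd.iterated_deriv (hf.analyticOnNhd isOpen_ball) k).continuousOn

lemma wt_cont (β : ℝ) : ContinuousOn (fun z : ℂ => (1 - ‖z‖ ^ 2) ^ β) (ball 0 1) := by
  refine ContinuousOn.rpow_const (by fun_prop) fun z hz => Or.inl ?_
  rw [mem_ball_zero_iff] at hz
  nlinarith [norm_nonneg z]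

lemma F_cont (f : ℂ → ℂ) (hf : DifferentiableOn ℂ f (ball 0 1)) (k : ℕ) (p β : ℝ) (hp : 1 ≤ p) :
    ContinuousOn (fun z => ‖iteratedDeriv k f z‖ ^ p * (1 - ‖z‖^2) ^ β) (ball 0 1) := by
  refine ContinuousOn.mul ?_ (wt_cont β)
  exact (iter_cont f hf k).norm.rpow_const fun z hz => Or.inr (by linarith)

lemma fin_T (p q α ζ : ℝ) (hp : 1 ≤ p) (hq : 1 ≤ q) (hζ : 1/2 < ζ) (k : ℕ)
    (f : ℂ → ℂ) (hf : DifferentiableOn ℂ f (ball 0 1))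
    (hfin : tentG p q ζ Set.univ (fun z => ‖f z‖ ^ p * (1 - ‖z‖^2) ^ α) < ⊤) :
    tentG p q ζ Set.univ
      (fun z => ‖iteratedDeriv k f z‖ ^ p * (1 - ‖z‖^2) ^ ((k:ℝ)*p + α)) < ⊤ := by
  have hs : 0 < q / p := by positivity
  rw [tentG_eq] at hfin ⊢
  set s := q / p with hsd
  -- parameters
  obtain ⟨t, ht0, ht1, ht2⟩ : ∃ t : ℝ, 0 < t ∧ t ≤ 1 / 2 ∧ ζ * t ≤ (2 * ζ - 1) / 2 := by
    refine ⟨min (1 / 2) ((2 * ζ - 1) / (2 * ζ)), lt_min (by norm_num) (div_pos (by linarith) (by linarith)),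
      min_le_left _ _, ?_⟩
    calc ζ * min (1 / 2) ((2 * ζ - 1) / (2 * ζ)) ≤ ζ * ((2 * ζ - 1) / (2 * ζ)) := by
          gcongr; exact min_le_right _ _
      _ = _ := by field_simp
  obtain ⟨c1, hc0, hc1, hc2⟩ : ∃ c1 : ℝ, 0 < c1 ∧ c1 ≤ 1 ∧ c1 ≤ (2 * ζ - 1) / 4 :=
    ⟨min 1 ((2 * ζ - 1) / 4), lt_min one_pos (by linarith), min_le_left _ _, min_le_right _ _⟩
  obtain ⟨R, hR1, hR2⟩ : ∃ R : ℝ, 1 ≤ R ∧ 8 * ζ + 5 ≤ R * c1 :=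
    ⟨max 1 ((8 * ζ + 5) / c1), le_max_left _ _, by
      rw [← div_le_iff₀ hc0]; exact le_max_right _ _⟩
  set H : ℂ → ℝ≥0∞ := (ball (0:ℂ) 1).indicator
    (fun w => ENNReal.ofReal (‖f w‖ ^ p * (1 - ‖w‖^2) ^ α)) with hH
  have hHm : Measurable H := by
    refine ind_meas _ isOpen_ball (fun w => ‖f w‖ ^ p * (1 - ‖w‖^2) ^ α) ?_ _ ENNReal.measurable_ofReal
    have := F_cont f hf 0 p α hp
    simpa using this
  set Ann : Set ℂ := {w | 1 - t ≤ ‖w‖ ∧ ‖w‖ < 1} with hAnn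
  have hAnnm : MeasurableSet Ann :=
    (measurableSet_le (f := fun _ : ℂ => 1 - t) (g := fun w : ℂ => ‖w‖) (by fun_prop)
      (by fun_prop)).inter (measurableSet_lt (f := fun w : ℂ => ‖w‖) (g := fun _ : ℂ => 1)
      (by fun_prop) (by fun_prop))
  set ν : Measure ℂ := (volume.restrict Ann).withDensity H with hν
  have hcm := cen_meas
  have hrm : Measurable fun w : ℂ => c1 * (1 - ‖w‖) := by fun_prop
  have hE : ∀ (x : AddCircle (2 * Real.pi)) (ρ : ℂ → ℝ), Measurable ρ →
      MeasurableSet {w | x ∈ ball (cen w) (ρ w)} := by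
    intro x ρ hρ
    exact measurableSet_lt (measurable_const.dist hcm) hρ
  have hνE : ∀ E : Set ℂ, MeasurableSet E → ν E = ∫⁻ w in E ∩ Ann, H w := by
    intro E hEm
    rw [hν, withDensity_apply _ hEm, Measure.restrict_restrict hEm]
  have hA : ∫⁻ x, ν {y | x ∈ ball (cen y) (c1 * (1 - ‖y‖))} ^ s ≠ ⊤ := by
    refine (lt_of_le_of_lt (lintegral_mono fun x => ?_) hfin).ne
    refine ENNReal.rpow_le_rpow ?_ hs.le
    rw [hνE _ (hE x _ hrm)]
    refine lintegral_mono' (Measure.restrict_mono ?_ le_rfl) (Set.indicator_le_self' (fun _ _ => zero_le))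
    rintro w ⟨hw, hw1, hw2⟩
    refine ⟨⟨by simpa using hw2, ?_⟩, trivial⟩
    have h1 : dist x (cen w) < c1 * (1 - ‖w‖) := hw
    have h2 := chord_le x (cen w)
    have h3 := cen_dist w hw2.le
    have h4 := norm_sub_le_norm_sub_add_norm_sub w (ecirc (cen w)) (ecirc x)
    rw [norm_sub_rev (ecirc (cen w))] at h4
    have h5 : 1 + c1 < ζ * (1 + ‖w‖) := by nlinarith
    have h6 : (1 + c1) * (1 - ‖w‖) < ζ * (1 + ‖w‖) * (1 - ‖w‖) :=
      mul_lt_mul_of_pos_right h5 (by linarith)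
    nlinarith
  have hAp := aper (volume : Measure (AddCircle (2 * Real.pi))) R hR1 circ_doub ν cen
    (fun w => c1 * (1 - ‖w‖)) hcm hrm
    (by
      have : ∀ᵐ w ∂ν, w ∈ Ann :=
        (withDensity_absolutelyContinuous _ _).ae_le (ae_restrict_mem hAnnm)
      filter_upwards [this] with w hw
      have := hw.2
      have := norm_nonneg w
      exact ⟨by apply mul_pos hc0; linarith, by nlinarith⟩) s hs hA
  obtain ⟨K, hK, hcone⟩ := cone_bound p α hp k
  set F : ℂ → ℝ := fun z => ‖iteratedDeriv k f z‖ ^ p * (1 - ‖z‖^2) ^ ((k:ℝ)*p + α) with hF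
  have hFc : ContinuousOn F (ball 0 1) := F_cont f hf k p _ hp
  set B := ∫⁻ z in closedBall (0:ℂ) (1 - 2 * t / 3), ENNReal.ofReal (F z) with hB
  have hBt : B ≠ ⊤ := by
    have : IntegrableOn F (closedBall (0:ℂ) (1 - 2 * t / 3)) :=
      (hFc.mono (closedBall_subset_ball (by linarith))).integrableOn_compact (isCompact_closedBall _ _)
    exact this.lintegral_lt_top.ne
  have hpt : ∀ x, ∫⁻ z in ntReg ζ (ecirc x) ∩ univ, ENNReal.ofReal (F z) ≤
      B + K * ν {y | x ∈ ball (cen y) (R * (c1 * (1 - ‖y‖)))} := by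
    intro x
    have hEm := hE x (fun y => R * (c1 * (1 - ‖y‖))) (by fun_prop)
    set E := {y | x ∈ ball (cen y) (R * (c1 * (1 - ‖y‖)))} with hEd
    set Z := ntReg ζ (ecirc x) ∩ {z | 1 - ‖z‖ ≤ 2 * t / 3} with hZ
    have hZm : MeasurableSet Z := (nt_meas _ _).inter (measurableSet_le (by fun_prop) (by fun_prop))
    have hsub : ntReg ζ (ecirc x) ∩ univ ⊆ closedBall (0:ℂ) (1 - 2 * t / 3) ∪ Z := by
      rintro z ⟨hz, -⟩
      by_cases h : 1 - ‖z‖ ≤ 2 * t / 3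
      · exact Or.inr ⟨hz, h⟩
      · left; rw [mem_closedBall_zero_iff]; linarith
    refine (lintegral_mono_set hsub).trans ((lintegral_union_le _ _ _).trans ?_)
    refine add_le_add le_rfl ?_
    rw [hνE _ hEm]
    refine hcone f hf H hHm (fun w hw => by rw [hH, Set.indicator_of_mem hw]) Z (E ∩ Ann) hZm
      (hEm.inter hAnnm) (fun z hz => hz.1.1) (fun w hw => by simpa using hw.2.2) ?_
    rintro z ⟨⟨hz1, hz2⟩, hz3⟩ w hw
    rw [mem_ball_zero_iff] at hz1
    have hz3' : 1 - ‖z‖ ≤ 2 * t / 3 := hz3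
    have hz0 := norm_nonneg z
    have h1 := norm_sub_norm_le w z
    have h2 := norm_sub_norm_le z w
    rw [norm_sub_rev z w] at h2
    have hw1 : ‖w‖ < 1 := by linarith
    have h3 := cen_dist w hw1.le
    have h4 := norm_sub_le_norm_sub_add_norm_sub (ecirc x) w (ecirc (cen w))
    have h5 := norm_sub_le_norm_sub_add_norm_sub (ecirc x) z w
    rw [norm_sub_rev (ecirc x) z, norm_sub_rev z w] at h5
    have h6 : ζ * (1 - ‖z‖ ^ 2) ≤ 4 * ζ * (1 - ‖w‖) := by
      have : 1 - ‖z‖ ^ 2 ≤ 4 * (1 - ‖w‖) := by nlinarith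
      nlinarith
    have h7 := dist_le_chord x (cen w)
    refine ⟨?_, by linarith, hw1⟩
    show dist x (cen w) < R * (c1 * (1 - ‖w‖))
    have h8 : (8 * ζ + 5) * (1 - ‖w‖) ≤ R * c1 * (1 - ‖w‖) :=
      mul_le_mul_of_nonneg_right hR2 (by linarith)
    nlinarith
  calc _ ≤ ∫⁻ x, 2 ^ s * (B ^ s + K ^ s * ν {y | x ∈ ball (cen y) (R * (c1 * (1 - ‖y‖)))} ^ s) := by
        refine lintegral_mono fun x => ?_
        refine (ENNReal.rpow_le_rpow (hpt x) hs.le).trans ((rpow_add_le _ _ s hs).trans ?_)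
        rw [ENNReal.mul_rpow_of_nonneg _ _ hs.le]
    _ = 2 ^ s * (B ^ s * volume (univ : Set (AddCircle (2 * Real.pi))) +
        K ^ s * ∫⁻ x, ν {y | x ∈ ball (cen y) (R * (c1 * (1 - ‖y‖)))} ^ s) := by
        rw [lintegral_const_mul' _ _ (ENNReal.rpow_ne_top_of_nonneg hs.le (by simp)),
          lintegral_add_left measurable_const, lintegral_const,
          lintegral_const_mul' _ _ (ENNReal.rpow_ne_top_of_nonneg hs.le hK)]
    _ < ⊤ := by
        refine ENNReal.mul_lt_top (ENNReal.rpow_lt_top_of_nonneg hs.le (by simp)) (ENNReal.add_lt_top.2 ⟨?_, ?_⟩)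
        · exact ENNReal.mul_lt_top (ENNReal.rpow_lt_top_of_nonneg hs.le hBt) (measure_lt_top _ _)
        · exact ENNReal.mul_lt_top (ENNReal.rpow_lt_top_of_nonneg hs.le hK) (Ne.lt_top hAp)

lemma bloch_bd (g : ℂ → ℂ) (hg : DifferentiableOn ℂ g (ball 0 1))
    (hgBloch : ∃ M : ℝ, ∀ z ∈ ball (0:ℂ) 1, (1 - ‖z‖^2) * ‖deriv g z‖ ≤ M) (m : ℕ) (hm : 0 < m) :
    ∃ M' : ℝ, 1 ≤ M' ∧ ∀ z ∈ ball (0:ℂ) 1, ‖iteratedDeriv m g z‖ * (1 - ‖z‖^2) ^ m ≤ M' := by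
  obtain ⟨M, hM⟩ := hgBloch
  obtain ⟨j, rfl⟩ : ∃ j, m = j + 1 := ⟨m - 1, by omega⟩
  have hM0 : 0 ≤ M := le_trans (by simp) (hM 0 (by simp))
  refine ⟨max 1 (j.factorial * M * 4 ^ (j + 1)), le_max_left _ _, fun z hz => le_max_of_le_right ?_⟩
  rw [mem_ball_zero_iff] at hz
  have hz0 := norm_nonneg z
  set ρ := (1 - ‖z‖) / 2 with hρ
  have hρ0 : 0 < ρ := by linarith
  have hin : ∀ w ∈ closedBall z ρ, ρ ≤ 1 - ‖w‖ := by
    intro w hw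
    rw [mem_closedBall_iff_norm] at hw
    have h1 := norm_sub_norm_le w z
    linarith
  have hsub : closedBall z ρ ⊆ ball 0 1 := fun w hw => by
    have := hin w hw
    rw [mem_ball_zero_iff]; linarith
  have hd : DiffContOnCl ℂ (deriv g) (ball z ρ) := by
    apply DifferentiableOn.diffContOnCl
    exact (hg.deriv isOpen_ball).mono (closure_ball_subset_closedBall.trans hsub)
  have hc := Complex.norm_iteratedDeriv_le_of_forall_mem_sphere_norm_le j hρ0 hd (C := M / ρ) (by
    intro w hw
    have hw' := sphere_subset_closedBall hw
    have h1 := hM w (hsub hw')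
    have h2 := hin w hw'
    rw [le_div_iff₀ hρ0]
    have h3 : ρ ≤ 1 - ‖w‖ ^ 2 := by nlinarith [norm_nonneg w]
    nlinarith [norm_nonneg (deriv g w)])
  rw [iteratedDeriv_succ']
  have h4 : (1 - ‖z‖ ^ 2) ^ (j + 1) ≤ (4 * ρ) ^ (j + 1) := by
    apply pow_le_pow_left₀ <;> nlinarith
  have h5 : 0 ≤ 1 - ‖z‖ ^ 2 := by nlinarith
  calc _ ≤ (j.factorial * (M / ρ) / ρ ^ j) * (4 * ρ) ^ (j + 1) := by gcongr
    _ = _ := by rw [mul_pow]; field_simp; ring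

end finiteness2

theorem stmt13 (p q α ζ : ℝ) (hp : 1 ≤ p) (hq : 1 ≤ q) (hα : -2 < α) (hζ : 1/2 < ζ)
    (n k : ℕ) (hk : k < n)
    (g : ℂ → ℂ) (hg : DifferentiableOn ℂ g (Metric.ball 0 1))
    (hgBloch : ∃ M : ℝ, ∀ z ∈ Metric.ball (0:ℂ) 1, (1 - ‖z‖^2) * ‖deriv g z‖ ≤ M)
    (C : ℝ) (hC : 0 < C)
    (hbelow : ∀ f : ℂ → ℂ, DifferentiableOn ℂ f (Metric.ball 0 1) →
      tentG p q ζ Set.univ (fun z => ‖f z‖ ^ p * (1 - ‖z‖^2) ^ α) < ⊤ →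
      ENNReal.ofReal C *
          tentG p q ζ Set.univ
            (fun z => ‖iteratedDeriv k f z‖ ^ p * (1 - ‖z‖^2) ^ ((k:ℝ)*p + α))
        ≤ tentG p q ζ Set.univ
            (fun z => ‖iteratedDeriv k f z‖ ^ p * ‖iteratedDeriv (n-k) g z‖ ^ p *
              (1 - ‖z‖^2) ^ ((n:ℝ)*p + α))) :
    ∃ c₀ > 0, ∀ c : ℝ, 0 < c → c < c₀ →
      ∃ C₅ > 0, ∀ f : ℂ → ℂ, DifferentiableOn ℂ f (Metric.ball 0 1) →
        tentG p q ζ Set.univ (fun z => ‖f z‖ ^ p * (1 - ‖z‖^2) ^ α) < ⊤ →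
        ENNReal.ofReal C₅ *
            tentG p q ζ Set.univ
              (fun z => ‖iteratedDeriv k f z‖ ^ p * (1 - ‖z‖^2) ^ ((k:ℝ)*p + α))
          ≤ tentG p q ζ
              {z ∈ Metric.ball (0:ℂ) 1 | c < ‖iteratedDeriv (n-k) g z‖ * (1 - ‖z‖^2) ^ (n-k)}
              (fun z => ‖iteratedDeriv k f z‖ ^ p * (1 - ‖z‖^2) ^ ((k:ℝ)*p + α)) := by
  have hp0 : 0 < p := by linarith
  have hq0 : 0 < q := by linarith
  have hs : 0 < q / p := by positivity
  obtain ⟨M', hM1, hM'⟩ := bloch_bd g hg hgBloch (n - k) (by omega)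
  have h2s : (0:ℝ) < 2 ^ (q / p) := by positivity
  have hb0 : 0 < C / (2 * 2 ^ (q / p)) := by positivity
  refine ⟨(C / (2 * 2 ^ (q / p))) ^ (1 / q), by positivity, fun c hc hcc => ?_⟩
  have hcq : 2 ^ (q / p) * c ^ q ≤ C / 2 := by
    have h1 : c ^ q ≤ C / (2 * 2 ^ (q / p)) := by
      have := Real.rpow_le_rpow hc.le hcc.le hq0.le
      rwa [← Real.rpow_mul hb0.le, one_div_mul_cancel hq0.ne', Real.rpow_one] at this
    rw [le_div_iff₀ (by positivity)] at h1
    linarith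
  have ha0 : 0 < 2 ^ (q / p) * M' ^ q := by positivity
  refine ⟨C / 2 / (2 ^ (q / p) * M' ^ q), by positivity, fun f hf hfin => ?_⟩
  have hT := fin_T p q α ζ hp hq hζ k f hf hfin
  have hb := hbelow f hf hfin
  set G := {z ∈ Metric.ball (0:ℂ) 1 | c < ‖iteratedDeriv (n-k) g z‖ * (1 - ‖z‖^2) ^ (n-k)} with hG
  have hGm : MeasurableSet G := by
    have hcont : ContinuousOn (fun z => ‖iteratedDeriv (n-k) g z‖ * (1 - ‖z‖^2) ^ (n-k))
        (ball (0:ℂ) 1) := (iter_cont g hg (n - k)).norm.mul (by fun_prop)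
    exact (hcont.isOpen_inter_preimage isOpen_ball isOpen_Ioi).measurableSet
  set F : ℂ → ℝ := fun z => ‖iteratedDeriv k f z‖ ^ p * (1 - ‖z‖^2) ^ ((k:ℝ)*p + α) with hF
  have hFc : ContinuousOn F (ball 0 1) := F_cont f hf k p _ hp
  -- pointwise identity
  have hpt : ∀ z ∈ ball (0:ℂ) 1, ‖iteratedDeriv k f z‖ ^ p * ‖iteratedDeriv (n-k) g z‖ ^ p *
      (1 - ‖z‖^2) ^ ((n:ℝ)*p + α) =
      (‖iteratedDeriv (n-k) g z‖ * (1 - ‖z‖^2) ^ (n-k)) ^ p * F z := by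
    intro z hz
    rw [mem_ball_zero_iff] at hz
    have h0 : 0 < 1 - ‖z‖ ^ 2 := by nlinarith [norm_nonneg z]
    have hn : (n:ℝ) * p + α = ((n - k : ℕ) : ℝ) * p + ((k:ℝ) * p + α) := by
      rw [Nat.cast_sub hk.le]; ring
    rw [hn, Real.rpow_add h0, Real.rpow_mul h0.le, Real.rpow_natCast,
      Real.mul_rpow (norm_nonneg _) (by positivity), hF]
    ring
  have hF0 : ∀ z ∈ ball (0:ℂ) 1, 0 ≤ F z := by
    intro z hz
    rw [mem_ball_zero_iff] at hz
    have h0 : 0 < 1 - ‖z‖ ^ 2 := by nlinarith [norm_nonneg z]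
    rw [hF]; positivity
  have hinner : ∀ x : AddCircle (2 * Real.pi), ∫⁻ z in ntReg ζ (ecirc x) ∩ univ,
      ENNReal.ofReal (‖iteratedDeriv k f z‖ ^ p * ‖iteratedDeriv (n-k) g z‖ ^ p *
      (1 - ‖z‖^2) ^ ((n:ℝ)*p + α)) ≤
      ENNReal.ofReal (M' ^ p) * (∫⁻ z in ntReg ζ (ecirc x) ∩ G, ENNReal.ofReal (F z)) +
      ENNReal.ofReal (c ^ p) * (∫⁻ z in ntReg ζ (ecirc x) ∩ univ, ENNReal.ofReal (F z)) := by
    intro x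
    have hbase : ∀ z ∈ ball (0:ℂ) 1, ∀ L : ℝ, 0 ≤ L →
        ‖iteratedDeriv (n-k) g z‖ * (1 - ‖z‖^2) ^ (n-k) ≤ L →
        ENNReal.ofReal (‖iteratedDeriv k f z‖ ^ p * ‖iteratedDeriv (n-k) g z‖ ^ p *
          (1 - ‖z‖^2) ^ ((n:ℝ)*p + α)) ≤ ENNReal.ofReal (L ^ p) * ENNReal.ofReal (F z) := by
      intro z hz L hL hle
      rw [hpt z hz, ← ENNReal.ofReal_mul (by positivity)]
      apply ENNReal.ofReal_le_ofReal
      have h1 := hF0 z hz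
      have h0 : 0 ≤ 1 - ‖z‖ ^ 2 := by
        rw [mem_ball_zero_iff] at hz
        nlinarith [norm_nonneg z]
      gcongr
    have hsub : ntReg ζ (ecirc x) ∩ univ ⊆ (ntReg ζ (ecirc x) ∩ G) ∪ (ntReg ζ (ecirc x) ∩ Gᶜ) := by
      rintro z ⟨hz, -⟩
      by_cases h : z ∈ G
      · exact Or.inl ⟨hz, h⟩
      · exact Or.inr ⟨hz, h⟩
    refine (lintegral_mono_set hsub).trans ((lintegral_union_le _ _ _).trans ?_)
    refine add_le_add ?_ ?_
    · rw [← lintegral_const_mul' _ _ ENNReal.ofReal_ne_top]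
      refine setLIntegral_mono' ((nt_meas _ _).inter hGm) fun z hz => ?_
      exact hbase z hz.1.1 M' (by linarith) (hM' z hz.1.1)
    · rw [← lintegral_const_mul' _ _ ENNReal.ofReal_ne_top]
      refine (setLIntegral_mono' ((nt_meas _ _).inter hGm.compl) fun z hz => ?_).trans
        (lintegral_mono_set (inter_subset_inter_right _ (subset_univ _)))
      refine hbase z hz.1.1 c hc.le ?_
      by_contra hcon
      exact hz.2 ⟨hz.1.1, not_le.1 hcon⟩
  have hpow : ∀ (L : ℝ) (a : ℝ≥0∞), 0 ≤ L →
      (ENNReal.ofReal (L ^ p) * a) ^ (q / p) = ENNReal.ofReal (L ^ q) * a ^ (q / p) := by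
    intro L a hL
    rw [ENNReal.mul_rpow_of_nonneg _ _ hs.le, ENNReal.ofReal_rpow_of_nonneg (by positivity) hs.le,
      ← Real.rpow_mul hL, mul_div_cancel₀ _ hp0.ne']
  have h2e : (2:ℝ≥0∞) ^ (q / p) = ENNReal.ofReal (2 ^ (q / p)) := by
    rw [← ENNReal.ofReal_rpow_of_nonneg (by norm_num) hs.le]; simp
  have hmain : tentG p q ζ Set.univ
            (fun z => ‖iteratedDeriv k f z‖ ^ p * ‖iteratedDeriv (n-k) g z‖ ^ p *
              (1 - ‖z‖^2) ^ ((n:ℝ)*p + α)) ≤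
      ENNReal.ofReal (2 ^ (q / p)) * (ENNReal.ofReal (M' ^ q) * tentG p q ζ G F +
        ENNReal.ofReal (c ^ q) * tentG p q ζ Set.univ F) := by
    rw [tentG_eq, tentG_eq, tentG_eq]
    rw [← lintegral_const_mul' _ _ ENNReal.ofReal_ne_top,
      ← lintegral_const_mul' _ _ ENNReal.ofReal_ne_top,
      ← lintegral_add_left (((inner_meas ζ G hGm F hFc).pow_const _).const_mul _),
      ← lintegral_const_mul' _ _ ENNReal.ofReal_ne_top]
    refine lintegral_mono fun x => ?_
    refine (ENNReal.rpow_le_rpow (hinner x) hs.le).trans ((rpow_add_le _ _ _ hs).trans ?_)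
    rw [hpow M' _ (by linarith), hpow c _ hc.le, h2e]
  set T := tentG p q ζ Set.univ F with hTd
  set TG := tentG p q ζ G F with hTG
  have h3 : ENNReal.ofReal (C / 2) * T + ENNReal.ofReal (C / 2) * T ≤
      ENNReal.ofReal (2 ^ (q / p) * M' ^ q) * TG + ENNReal.ofReal (C / 2) * T := by
    calc _ = ENNReal.ofReal C * T := by
          rw [← add_mul, ← ENNReal.ofReal_add (by positivity) (by positivity), add_halves]
      _ ≤ _ := hb.trans hmain
      _ = ENNReal.ofReal (2 ^ (q / p) * M' ^ q) * TG + ENNReal.ofReal (2 ^ (q / p) * c ^ q) * T := by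
          rw [ENNReal.ofReal_mul h2s.le, ENNReal.ofReal_mul h2s.le]; ring
      _ ≤ _ := by gcongr
  have h4 : ENNReal.ofReal (C / 2) * T ≤ ENNReal.ofReal (2 ^ (q / p) * M' ^ q) * TG :=
    ENNReal.le_of_add_le_add_right (ENNReal.mul_ne_top ENNReal.ofReal_ne_top hT.ne) h3
  have h5 : ENNReal.ofReal (C / 2) = ENNReal.ofReal (2 ^ (q / p) * M' ^ q) *
      ENNReal.ofReal (C / 2 / (2 ^ (q / p) * M' ^ q)) := by
    rw [← ENNReal.ofReal_mul ha0.le]; congr 1; field_simp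
  rw [h5, mul_assoc] at h4
  exact (ENNReal.mul_le_mul_iff_right (by simpa using ha0) ENNReal.ofReal_ne_top).1 h4
end
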